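/- arXiv:2604.04505 — 2 statements merged into one kernel-verified Lean document; each statement's English description precedes it below -/
import Mathlib

section
/- Let K be a field and A a finite dimensional K-algebra. Then the following conditions are equivalent: (a) A is brick finite; (b) there are only finitely many torsion classes in mod A; (c) every torsion class in mod A is functorially finite; (d) every torsion class in mod A is bicompact; (e) every torsion class in mod A is compact; (f) every torsion class in mod A is widely generated. -/
namespace TorsPaper

variable (A : Type) [Ring A]

/-- `N` is (isomorphic to) a factor module of `M`. -/
def IsQuotientOf (N M : ModuleCat.{0} A) : Prop :=
  ∃ f : M →ₗ[A] N, Function.Surjective f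

/-- `L` is (isomorphic to) a submodule of `M`. -/
def IsSubmoduleOf (L M : ModuleCat.{0} A) : Prop :=
  ∃ f : L →ₗ[A] M, Function.Injective f

/-- `M` is a nonzero module. -/
def Nonzero (M : ModuleCat.{0} A) : Prop := ∃ x : M, x ≠ 0

/-- A torsion class in `mod A`: a class of finitely generated modules, containing the zero
modules, closed under isomorphisms (which follows from `quot`), factor modules and
extensions. -/
structure IsTorsionClass (T : ModuleCat.{0} A → Prop) : Prop where
  fin : ∀ M, T M → Module.Finite A M
  zero : ∀ M : ModuleCat.{0} A, (∀ x : M, x = 0) → T M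
  quot : ∀ M N : ModuleCat.{0} A, T M → Module.Finite A N → IsQuotientOf A N M → T N
  ext : ∀ M : ModuleCat.{0} A, Module.Finite A M → ∀ N : Submodule A M,
    T (ModuleCat.of A N) → T (ModuleCat.of A (M ⧸ N)) → T M

/-- A torsion-free class in `mod A`. -/
structure IsTorsionFreeClass (F : ModuleCat.{0} A → Prop) : Prop where
  fin : ∀ M, F M → Module.Finite A M
  zero : ∀ M : ModuleCat.{0} A, (∀ x : M, x = 0) → F M
  sub : ∀ M N : ModuleCat.{0} A, F M → Module.Finite A N → IsSubmoduleOf A N M → F N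
  ext : ∀ M : ModuleCat.{0} A, Module.Finite A M → ∀ N : Submodule A M,
    F (ModuleCat.of A N) → F (ModuleCat.of A (M ⧸ N)) → F M

/-- The right Hom-perpendicular class `T^⊥` inside `mod A`. -/
def rightPerp (T : ModuleCat.{0} A → Prop) : ModuleCat.{0} A → Prop :=
  fun X => Module.Finite A X ∧ ∀ M : ModuleCat.{0} A, T M → ∀ f : M →ₗ[A] X, f = 0

/-- The smallest torsion class containing a class `S` of modules. -/
def torsClosure (S : ModuleCat.{0} A → Prop) : ModuleCat.{0} A → Prop :=
  fun X => ∀ T : ModuleCat.{0} A → Prop, IsTorsionClass A T → (∀ Y, S Y → T Y) → T X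

/-- The smallest torsion-free class containing a class `S` of modules. -/
def torfClosure (S : ModuleCat.{0} A → Prop) : ModuleCat.{0} A → Prop :=
  fun X => ∀ F : ModuleCat.{0} A → Prop, IsTorsionFreeClass A F → (∀ Y, S Y → F Y) → F X

/-- A torsion class is compact if it is the smallest torsion class containing a single
module `M`. -/
def IsCompactTors (T : ModuleCat.{0} A → Prop) : Prop :=
  ∃ M : ModuleCat.{0} A, Module.Finite A M ∧ T = torsClosure A (fun X => X = M)

/-- A torsion class is cocompact if `T^⊥` is the smallest torsion-free class containing a
single module `N`. -/
def IsCocompactTors (T : ModuleCat.{0} A → Prop) : Prop :=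
  ∃ N : ModuleCat.{0} A, Module.Finite A N ∧ rightPerp A T = torfClosure A (fun X => X = N)

/-- A torsion class is bicompact if it is both compact and cocompact. -/
def IsBicompactTors (T : ModuleCat.{0} A → Prop) : Prop :=
  IsCompactTors A T ∧ IsCocompactTors A T

/-- A class `C` of modules is functorially finite in `mod A` if every finitely generated
module has a left `C`-approximation and a right `C`-approximation. -/
def FunctoriallyFinite (C : ModuleCat.{0} A → Prop) : Prop :=
  (∀ M : ModuleCat.{0} A, Module.Finite A M →
    ∃ (X : ModuleCat.{0} A) (f : M →ₗ[A] X), C X ∧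
      ∀ Y : ModuleCat.{0} A, C Y → ∀ g : M →ₗ[A] Y, ∃ h : X →ₗ[A] Y, h.comp f = g) ∧
  (∀ M : ModuleCat.{0} A, Module.Finite A M →
    ∃ (X : ModuleCat.{0} A) (f : X →ₗ[A] M), C X ∧
      ∀ Y : ModuleCat.{0} A, C Y → ∀ g : Y →ₗ[A] M, ∃ h : Y →ₗ[A] X, f.comp h = g)

/-- A stability function: a real-valued function on `mod A` which is additive on short
exact sequences. -/
def IsStability (θ : ModuleCat.{0} A → ℝ) : Prop :=
  ∀ L M N : ModuleCat.{0} A, Module.Finite A L → Module.Finite A M → Module.Finite A N →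
    ∀ (f : L →ₗ[A] M) (g : M →ₗ[A] N), Function.Injective f → Function.Surjective g →
      LinearMap.range f = LinearMap.ker g → θ M = θ L + θ N

/-- The semistable torsion class `T_θ`. -/
def tTheta (θ : ModuleCat.{0} A → ℝ) : ModuleCat.{0} A → Prop :=
  fun M => Module.Finite A M ∧ ∀ N : ModuleCat.{0} A, Module.Finite A N →
    IsQuotientOf A N M → Nonzero A N → 0 < θ N

/-- The semistable torsion class `\bar T_θ`. -/
def tThetaBar (θ : ModuleCat.{0} A → ℝ) : ModuleCat.{0} A → Prop :=
  fun M => Module.Finite A M ∧ ∀ N : ModuleCat.{0} A, Module.Finite A N →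
    IsQuotientOf A N M → 0 ≤ θ N

/-- The semistable torsion-free class `F_θ`. -/
def fTheta (θ : ModuleCat.{0} A → ℝ) : ModuleCat.{0} A → Prop :=
  fun M => Module.Finite A M ∧ ∀ L : ModuleCat.{0} A, Module.Finite A L →
    IsSubmoduleOf A L M → Nonzero A L → θ L < 0

/-- The semistable torsion-free class `\bar F_θ`. -/
def fThetaBar (θ : ModuleCat.{0} A → ℝ) : ModuleCat.{0} A → Prop :=
  fun M => Module.Finite A M ∧ ∀ L : ModuleCat.{0} A, Module.Finite A L →
    IsSubmoduleOf A L M → θ L ≤ 0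

/-- An integer-valued function on `mod A` additive on short exact sequences; these are
exactly the group homomorphisms `K0(mod A) → ℤ`. -/
def IsAdditiveZ (φ : ModuleCat.{0} A → ℤ) : Prop :=
  ∀ L M N : ModuleCat.{0} A, Module.Finite A L → Module.Finite A M → Module.Finite A N →
    ∀ (f : L →ₗ[A] M) (g : M →ₗ[A] N), Function.Injective f → Function.Surjective g →
      LinearMap.range f = LinearMap.ker g → φ M = φ L + φ N

/-- `[X] = [Y]` in the Grothendieck group `K0(mod A)`: since `K0(mod A)` is free abelian
on the simple modules, this holds iff all additive `ℤ`-valued functions agree on `X`, `Y`. -/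
def SameK0Class (X Y : ModuleCat.{0} A) : Prop :=
  ∀ φ : ModuleCat.{0} A → ℤ, IsAdditiveZ A φ → φ X = φ Y

/-- Two classes of modules are numerically disjoint if they contain no nonzero `X`, `Y`
with `[X] = [Y] ≠ 0` in `K0(mod A)`. -/
def NumericallyDisjoint (C D : ModuleCat.{0} A → Prop) : Prop :=
  ¬ ∃ X Y : ModuleCat.{0} A, C X ∧ D Y ∧ Nonzero A X ∧ Nonzero A Y ∧ SameK0Class A X Y

/-- A brick: a finitely generated module whose endomorphism algebra is a division algebra,
i.e. `M` is nonzero and every nonzero endomorphism is invertible. -/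
def IsBrick (M : ModuleCat.{0} A) : Prop :=
  Module.Finite A M ∧ Nonzero A M ∧ ∀ f : M →ₗ[A] M, f ≠ 0 → Function.Bijective f

/-- A semibrick: a set of pairwise Hom-orthogonal bricks. -/
def IsSemibrick (S : Set (ModuleCat.{0} A)) : Prop :=
  (∀ M ∈ S, IsBrick A M) ∧
    ∀ M ∈ S, ∀ N ∈ S, M ≠ N → ∀ f : M →ₗ[A] N, f = 0


section Basics
variable {A : Type} [Ring A]

/-! ### Length -/

/-- The length of a module as a natural number. -/
noncomputable def len (X : ModuleCat.{0} A) : ℕ := (Module.length A X).toNat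

section Len
variable [IsArtinianRing A]

theorem length_ne_top' (X : ModuleCat.{0} A) (hX : Module.Finite A X) :
    Module.length A X ≠ ⊤ := Module.length_ne_top

theorem len_sub_lt (X : ModuleCat.{0} A) (hX : Module.Finite A X) (N : Submodule A X)
    (h : N ≠ ⊤) : len (ModuleCat.of A N) < len X := by
  unfold len
  have h1 : Module.length A N ≠ ⊤ := length_ne_top' (ModuleCat.of A N) inferInstance
  have h2 := length_ne_top' X hX
  rw [← Nat.cast_lt (α := ℕ∞), ENat.coe_toNat h1, ENat.coe_toNat h2]
  exact Submodule.length_lt h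

theorem len_quot_lt (X : ModuleCat.{0} A) (hX : Module.Finite A X) (N : Submodule A X)
    (h : N ≠ ⊥) : len (ModuleCat.of A (X ⧸ N)) < len X := by
  unfold len
  have h1 : Module.length A (X ⧸ N) ≠ ⊤ :=
    length_ne_top' (ModuleCat.of A (X ⧸ N)) inferInstance
  have h2 := length_ne_top' X hX
  rw [← Nat.cast_lt (α := ℕ∞), ENat.coe_toNat h1, ENat.coe_toNat h2]
  exact Submodule.length_quotient_lt N h

theorem len_eq_of_equiv {X Y : ModuleCat.{0} A} (e : X ≃ₗ[A] Y) : len X = len Y := by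
  unfold len; rw [e.length_eq]

theorem len_le_of_surj {X Y : ModuleCat.{0} A} (hX : Module.Finite A X) (f : X →ₗ[A] Y)
    (hf : Function.Surjective f) : len Y ≤ len X := by
  unfold len
  exact ENat.toNat_le_toNat (Module.length_le_of_surjective f hf) (length_ne_top' X hX)

theorem len_le_of_inj {X Y : ModuleCat.{0} A} (hY : Module.Finite A Y) (f : X →ₗ[A] Y)
    (hf : Function.Injective f) : len X ≤ len Y := by
  unfold len
  exact ENat.toNat_le_toNat (Module.length_le_of_injective f hf) (length_ne_top' Y hY)

theorem bij_of_surj_endo {X : ModuleCat.{0} A} (hX : Module.Finite A X) (f : X →ₗ[A] X)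
    (hf : Function.Surjective f) : Function.Bijective f :=
  ⟨IsNoetherian.injective_of_surjective_endomorphism f hf, hf⟩

/-- surjections both ways give an isomorphism -/
theorem bij_of_surj_len {X Y : ModuleCat.{0} A} (hX : Module.Finite A X) (f : X →ₗ[A] Y)
    (hf : Function.Surjective f) (h : len X ≤ len Y) : Function.Bijective f := by
  refine ⟨?_, hf⟩
  rw [← LinearMap.ker_eq_bot]
  by_contra hk
  have h1 := len_quot_lt X hX _ hk
  have h2 : len (ModuleCat.of A (X ⧸ LinearMap.ker f)) = len Y :=
    len_eq_of_equiv (f.quotKerEquivOfSurjective hf)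
  omega

end Len

/-! ### Torsion classes -/

variable {T : ModuleCat.{0} A → Prop}

theorem IsTorsionClass.surj (hT : IsTorsionClass A T) {X Y : ModuleCat.{0} A} (hX : T X)
    (f : X →ₗ[A] Y) (hf : Function.Surjective f) : T Y := by
  have := hT.fin X hX
  exact hT.quot X Y hX (Module.Finite.of_surjective f hf) ⟨f, hf⟩

theorem IsTorsionClass.range (hT : IsTorsionClass A T) {X Y : ModuleCat.{0} A} (hX : T X)
    (f : X →ₗ[A] Y) : T (ModuleCat.of A (LinearMap.range f)) :=
  hT.surj (Y := ModuleCat.of A (LinearMap.range f)) hX f.rangeRestrict f.surjective_rangeRestrict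

theorem IsTorsionClass.quotient (hT : IsTorsionClass A T) {X : ModuleCat.{0} A} (hX : T X)
    (N : Submodule A X) : T (ModuleCat.of A (X ⧸ N)) :=
  hT.surj (Y := ModuleCat.of A (X ⧸ N)) hX N.mkQ N.mkQ_surjective

theorem finite_of_ker {X Y : ModuleCat.{0} A} (f : X →ₗ[A] Y) 
    (h1 : Module.Finite A (LinearMap.ker f)) (h2 : Module.Finite A (LinearMap.range f)) :
    Module.Finite A X := by
  have : Module.Finite A (X ⧸ LinearMap.ker f) :=
    Module.Finite.equiv f.quotKerEquivRange.symm
  exact Module.Finite.of_submodule_quotient (LinearMap.ker f)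

/-- extension closure through a linear map -/
theorem IsTorsionClass.of_ker (hT : IsTorsionClass A T) {X Y : ModuleCat.{0} A}
    (f : X →ₗ[A] Y) (h1 : T (ModuleCat.of A (LinearMap.ker f)))
    (h2 : T (ModuleCat.of A (LinearMap.range f))) : T X := by
  have f1 : Module.Finite A (LinearMap.ker f) := hT.fin _ h1
  have f2 : Module.Finite A (LinearMap.range f) := hT.fin _ h2
  refine hT.ext X (finite_of_ker f f1 f2) (LinearMap.ker f) h1 ?_
  exact hT.surj (Y := ModuleCat.of A (X ⧸ LinearMap.ker f)) h2
    f.quotKerEquivRange.symm.toLinearMap f.quotKerEquivRange.symm.surjective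

theorem IsTorsionClass.prod (hT : IsTorsionClass A T) {X Y : ModuleCat.{0} A}
    (hX : T X) (hY : T Y) : T (ModuleCat.of A (X × Y)) := by
  refine hT.of_ker (X := ModuleCat.of A (X × Y)) (Y := Y) (LinearMap.snd A X Y) ?_ ?_
  · refine hT.surj (Y := ModuleCat.of A (LinearMap.ker (LinearMap.snd A X Y))) hX
      ((LinearMap.inl A X Y).codRestrict _ (by intro x; simp)) ?_
    rintro ⟨⟨x, y⟩, h⟩
    refine ⟨x, ?_⟩
    have : y = 0 := by simpa using h
    subst this
    rfl
  · refine hT.surj hY ((LinearMap.snd A X Y).rangeRestrict ∘ₗ LinearMap.inr A X Y) ?_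
    rintro ⟨y, h⟩
    exact ⟨y, by ext; simp⟩

theorem IsTorsionClass.pi (hT : IsTorsionClass A T) {X : ModuleCat.{0} A}
    (hX : T X) (n : ℕ) : T (ModuleCat.of A (Fin n → X)) := by
  induction n with
  | zero => exact hT.zero _ (fun x => Subsingleton.elim _ _)
  | succ n ih =>
    exact hT.surj (Y := ModuleCat.of A (Fin (n+1) → X)) (hT.prod hX ih)
      (Fin.consLinearEquiv A (fun _ => X)).toLinearMap (Fin.consLinearEquiv A (fun _ => X)).surjective

/-- Hom-left-perpendicular inside a torsion class is a torsion class. -/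
theorem IsTorsionClass.perp (hT : IsTorsionClass A T) (B : ModuleCat.{0} A) :
    IsTorsionClass A (fun X => T X ∧ ∀ f : X →ₗ[A] B, f = 0) where
  fin M h := hT.fin M h.1
  zero M h := ⟨hT.zero M h, fun f => by ext x; rw [h x]; simp⟩
  quot M N h hN := by
    rintro ⟨f, hf⟩
    refine ⟨hT.quot M N h.1 hN ⟨f, hf⟩, fun g => ?_⟩
    have := h.2 (g ∘ₗ f)
    ext y
    obtain ⟨x, rfl⟩ := hf y
    exact LinearMap.congr_fun this x
  ext M hM N h1 h2 := by
    refine ⟨hT.ext M hM N h1.1 h2.1, fun g => ?_⟩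
    have h3 := h1.2 (g ∘ₗ N.subtype)
    have h4 : N ≤ LinearMap.ker g := fun x hx => LinearMap.congr_fun h3 ⟨x, hx⟩
    have h5 := h2.2 (N.liftQ g h4)
    ext x
    exact LinearMap.congr_fun h5 (N.mkQ x)

/-- `X → B` all zero or surjective. -/
theorem IsTorsionClass.zeroOrSurj (hT : IsTorsionClass A T) (B : ModuleCat.{0} A) :
    IsTorsionClass A (fun X => T X ∧ ∀ f : X →ₗ[A] B, f = 0 ∨ Function.Surjective f) where
  fin M h := hT.fin M h.1
  zero M h := ⟨hT.zero M h, fun f => by left; ext x; rw [h x]; simp⟩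
  quot M N h hN := by
    rintro ⟨f, hf⟩
    refine ⟨hT.quot M N h.1 hN ⟨f, hf⟩, fun g => ?_⟩
    rcases h.2 (g ∘ₗ f) with h | h
    · left
      ext y
      obtain ⟨x, rfl⟩ := hf y
      exact LinearMap.congr_fun h x
    · right
      exact Function.Surjective.of_comp (g := f) h
  ext M hM N h1 h2 := by
    refine ⟨hT.ext M hM N h1.1 h2.1, fun g => ?_⟩
    rcases h1.2 (g ∘ₗ N.subtype) with h3 | h3
    · have h4 : N ≤ LinearMap.ker g := fun x hx => LinearMap.congr_fun h3 ⟨x, hx⟩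
      rcases h2.2 (N.liftQ g h4) with h5 | h5
      · left
        ext x
        exact LinearMap.congr_fun h5 (N.mkQ x)
      · right
        intro b
        obtain ⟨x, hx⟩ := h5 b
        obtain ⟨x, rfl⟩ := N.mkQ_surjective x
        exact ⟨x, hx⟩
    · right
      exact Function.Surjective.of_comp (g := N.subtype) h3

theorem isTorsionClass_all (hA : IsNoetherianRing A) :
    IsTorsionClass A (fun X => Module.Finite A X) where
  fin M h := h
  zero M h := by
    have : Subsingleton M := ⟨fun x y => by rw [h x, h y]⟩
    infer_instance
  quot M N h hN _ := hN
  ext M hM N _ _ := hM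

theorem isTorsionClass_zero : IsTorsionClass A (fun X => ∀ x : X, x = 0) where
  fin M h := by
    have : Subsingleton M := ⟨fun x y => by rw [h x, h y]⟩
    infer_instance
  zero M h := h
  quot M N h hN := by
    rintro ⟨f, hf⟩ y
    obtain ⟨x, rfl⟩ := hf y
    rw [h x]; simp
  ext M hM N h1 h2 x := by
    have : N.mkQ x = 0 := h2 _
    have h3 : x ∈ N := by simpa using this
    exact congrArg Subtype.val (h1 ⟨x, h3⟩)

/-- torsion submodule -/
theorem IsTorsionClass.exists_tors [IsNoetherianRing A] (hT : IsTorsionClass A T)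
    (X : ModuleCat.{0} A) (hX : Module.Finite A X) :
    ∃ N : Submodule A X, T (ModuleCat.of A N) ∧ rightPerp A T (ModuleCat.of A (X ⧸ N)) := by
  obtain ⟨N, hN, hmax⟩ := WellFounded.has_min (wellFounded_gt (α := Submodule A X))
    {N | T (ModuleCat.of A N)} ⟨⊥, hT.zero _ (fun x => Subsingleton.elim _ _)⟩
  refine ⟨N, hN, inferInstanceAs (Module.Finite A (X ⧸ N)), fun M hM f => ?_⟩
  let N' : Submodule A X := (LinearMap.range f).comap N.mkQ
  have hNN' : N ≤ N' := by
    intro x hx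
    refine ⟨0, ?_⟩
    rw [map_zero]; symm; simpa using hx
  let g : N' →ₗ[A] (LinearMap.range f) := 
    (N.mkQ ∘ₗ N'.subtype).codRestrict _ (fun x => x.2)
  have hN' : T (ModuleCat.of A N') := by
    refine hT.of_ker (X := ModuleCat.of A N') (Y := ModuleCat.of A (LinearMap.range f)) g ?_ ?_
    · refine hT.surj (Y := ModuleCat.of A (LinearMap.ker g)) hN
        ((Submodule.inclusion hNN').codRestrict _ ?_) ?_
      · intro x
        rw [LinearMap.mem_ker]
        apply Subtype.ext
        show N.mkQ (x : X) = 0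
        simp
      · rintro ⟨⟨x, hx⟩, hx'⟩
        have : N.mkQ x = 0 := congrArg Subtype.val hx'
        exact ⟨⟨x, by simpa using this⟩, rfl⟩
    · refine hT.surj (hT.range hM f) (Y := ModuleCat.of A (LinearMap.range g))
        (LinearMap.codRestrict _ LinearMap.id ?_) ?_
      · rintro ⟨y, hy⟩
        obtain ⟨x, rfl⟩ := N.mkQ_surjective y
        exact ⟨⟨x, hy⟩, rfl⟩
      · rintro ⟨y, hy⟩
        exact ⟨y, rfl⟩
  have hEq : N = N' := by
    by_contra h
    exact hmax N' hN' (lt_of_le_of_ne hNN' h)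
  ext m
  obtain ⟨x, hx⟩ := N.mkQ_surjective (f m)
  have : x ∈ N' := ⟨m, hx.symm⟩
  rw [← hEq] at this
  rw [← hx]; simpa using this

theorem rightPerp_sub {X Y : ModuleCat.{0} A} (hX : Module.Finite A X) (hY : rightPerp A T Y)
    (i : X →ₗ[A] Y) (hi : Function.Injective i) : rightPerp A T X := by
  refine ⟨hX, fun M hM f => ?_⟩
  have := hY.2 M hM (i ∘ₗ f)
  ext m
  apply hi
  simpa using LinearMap.congr_fun this m

theorem zero_of_perp {X : ModuleCat.{0} A} (h1 : T X) (h2 : rightPerp A T X) (x : X) : x = 0 :=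
  LinearMap.congr_fun (h2.2 X h1 LinearMap.id) x

/-- A torsion class contains every module all of whose maps to `T^⊥` vanish. -/
theorem IsTorsionClass.mem_of_perp [IsNoetherianRing A] (hT : IsTorsionClass A T)
    (X : ModuleCat.{0} A) (hX : Module.Finite A X)
    (h : ∀ Y, rightPerp A T Y → ∀ f : X →ₗ[A] Y, f = 0) : T X := by
  obtain ⟨N, h1, h2⟩ := hT.exists_tors X hX
  have h3 := h _ h2 N.mkQ
  refine hT.surj h1 N.subtype fun x => ?_
  have : N.mkQ x = 0 := LinearMap.congr_fun h3 x
  exact ⟨⟨x, by simpa using this⟩, rfl⟩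

/-- `rightPerp` is torsion-free. -/
theorem isTorsionFree_rightPerp [IsNoetherianRing A] :
    IsTorsionFreeClass A (rightPerp A T) where
  fin M h := h.1
  zero M h := by
    have : Subsingleton M := ⟨fun x y => by rw [h x, h y]⟩
    exact ⟨inferInstance, fun N _ f => by ext x; rw [h (f x)]; simp⟩
  sub M N h hN := by
    rintro ⟨f, hf⟩
    exact rightPerp_sub hN h f hf
  ext M hM N h1 h2 := by
    refine ⟨hM, fun Z hZ f => ?_⟩
    have h3 := h2.2 Z hZ (N.mkQ ∘ₗ f)
    have h4 : ∀ z, f z ∈ N := fun z => by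
      have := LinearMap.congr_fun h3 z
      simpa using this
    have h5 := h1.2 Z hZ (f.codRestrict N h4)
    ext z
    exact congrArg Subtype.val (LinearMap.congr_fun h5 z)

/-- The left perpendicular of a class. -/
def leftPerp (F : ModuleCat.{0} A → Prop) : ModuleCat.{0} A → Prop :=
  fun X => Module.Finite A X ∧ ∀ Y, F Y → ∀ f : X →ₗ[A] Y, f = 0

theorem isTorsion_leftPerp (F : ModuleCat.{0} A → Prop) : IsTorsionClass A (leftPerp F) where
  fin M h := h.1
  zero M h := by
    have : Subsingleton M := ⟨fun x y => by rw [h x, h y]⟩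
    exact ⟨inferInstance, fun N _ f => by ext x; rw [h x]; simp⟩
  quot M N h hN := by
    rintro ⟨f, hf⟩
    refine ⟨hN, fun Y hY g => ?_⟩
    have := h.2 Y hY (g ∘ₗ f)
    ext y
    obtain ⟨x, rfl⟩ := hf y
    exact LinearMap.congr_fun this x
  ext M hM N h1 h2 := by
    refine ⟨hM, fun Y hY g => ?_⟩
    have h3 := h1.2 Y hY (g ∘ₗ N.subtype)
    have h4 : N ≤ LinearMap.ker g := fun x hx => LinearMap.congr_fun h3 ⟨x, hx⟩
    have h5 := h2.2 Y hY (N.liftQ g h4)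
    ext x
    exact LinearMap.congr_fun h5 (N.mkQ x)

variable {F : ModuleCat.{0} A → Prop}

theorem IsTorsionFreeClass.inj (hF : IsTorsionFreeClass A F) [IsNoetherianRing A]
    {X Y : ModuleCat.{0} A} (hY : F Y)
    (f : X →ₗ[A] Y) (hf : Function.Injective f) : F X := by
  have := hF.fin Y hY
  exact hF.sub Y X hY (Module.Finite.of_injective f hf) ⟨f, hf⟩

theorem IsTorsionFreeClass.of_ker (hF : IsTorsionFreeClass A F) [IsNoetherianRing A]
    {X Y : ModuleCat.{0} A}
    (f : X →ₗ[A] Y) (h1 : F (ModuleCat.of A (LinearMap.ker f)))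
    (h2 : F (ModuleCat.of A (LinearMap.range f))) : F X := by
  have f1 : Module.Finite A (LinearMap.ker f) := hF.fin _ h1
  have f2 : Module.Finite A (LinearMap.range f) := hF.fin _ h2
  refine hF.ext X (finite_of_ker f f1 f2) (LinearMap.ker f) h1 ?_
  exact hF.inj (X := ModuleCat.of A (X ⧸ LinearMap.ker f)) h2
    f.quotKerEquivRange.toLinearMap f.quotKerEquivRange.injective

theorem IsTorsionFreeClass.perp_perp [IsNoetherianRing A] [IsArtinianRing A]
    (hF : IsTorsionFreeClass A F)
    (X : ModuleCat.{0} A) (h : rightPerp A (leftPerp F) X) : F X := by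
  have hX := h.1
  have h0 : F (ModuleCat.of A (X ⧸ (⊤ : Submodule A X))) :=
    hF.zero _ (fun x => Subsingleton.elim _ _)
  obtain ⟨N, hN, hmin⟩ := WellFounded.has_min (wellFounded_lt (α := Submodule A X))
    {N | F (ModuleCat.of A (X ⧸ N))} ⟨⊤, h0⟩
  have key : leftPerp F (ModuleCat.of A N) := by
    refine ⟨inferInstanceAs (Module.Finite A N), fun Y hY f => ?_⟩
    let N' : Submodule A X := (LinearMap.ker f).map N.subtype
    have hle : N' ≤ N := Submodule.map_subtype_le _ _
    have hN' : F (ModuleCat.of A (X ⧸ N')) := by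
      let g : (X ⧸ N') →ₗ[A] (X ⧸ N) := Submodule.factor hle
      refine hF.of_ker (X := ModuleCat.of A (X ⧸ N')) (Y := ModuleCat.of A (X ⧸ N)) g ?_ ?_
      · -- the kernel is `N / N'`, which embeds into `Y`
        let i : N →ₗ[A] LinearMap.ker g := (N'.mkQ ∘ₗ N.subtype).codRestrict _ (by
          intro x
          rw [LinearMap.mem_ker]
          show Submodule.factor hle (N'.mkQ x) = 0
          simp)
        have hi : Function.Surjective i := by
          rintro ⟨y, hy⟩
          obtain ⟨x, rfl⟩ := N'.mkQ_surjective y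
          have hx : N.mkQ x = 0 := hy
          exact ⟨⟨x, by simpa using hx⟩, rfl⟩
        have hker : LinearMap.ker i = LinearMap.ker f := by
          ext x
          constructor
          · intro hx
            have hx' : N'.mkQ (x : X) = 0 := congrArg Subtype.val hx
            have hx'' : (x : X) ∈ N' := by simpa using hx'
            obtain ⟨z, hz, hzx⟩ := hx''
            have : z = x := Subtype.ext hzx
            rwa [← this]
          · intro hx
            rw [LinearMap.mem_ker]
            apply Subtype.ext
            show N'.mkQ (x : X) = 0
            have : (x : X) ∈ N' := ⟨x, hx, rfl⟩
            simpa using this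
        let e1 := (i.quotKerEquivOfSurjective hi).symm
        let e2 := (Submodule.quotEquivOfEq _ _ hker)
        let e3 := f.quotKerEquivRange
        exact hF.inj (X := ModuleCat.of A (LinearMap.ker g)) hY
          ((LinearMap.range f).subtype ∘ₗ (e1.trans (e2.trans e3)).toLinearMap)
          (by
            rw [LinearMap.coe_comp]
            exact Function.Injective.comp (Submodule.injective_subtype _)
              (e1.trans (e2.trans e3)).injective)
      · exact hF.inj (X := ModuleCat.of A (LinearMap.range g)) hN (LinearMap.range g).subtype
          (Submodule.injective_subtype _)
    have hEq : N' = N := by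
      by_contra hne
      exact hmin N' hN' (lt_of_le_of_ne hle hne)
    ext x
    have hx : (x : X) ∈ N' := by rw [hEq]; exact x.2
    obtain ⟨z, hz, hzx⟩ := hx
    have : z = x := Subtype.ext hzx
    rw [← this]; exact hz
  have h3 := h.2 _ key N.subtype
  have hbot : N = ⊥ := by
    rw [eq_bot_iff]
    intro x hx
    exact LinearMap.congr_fun h3 ⟨x, hx⟩
  refine hF.inj hN N.mkQ ?_
  rw [← LinearMap.ker_eq_bot, Submodule.ker_mkQ, hbot]

/-! ### torsClosure -/

theorem torsClosure_isTorsion [IsNoetherianRing A] (S : ModuleCat.{0} A → Prop)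
    (hS : ∀ X, S X → Module.Finite A X) : IsTorsionClass A (torsClosure A S) where
  fin M h := h _ (isTorsionClass_all inferInstance) hS
  zero M h := fun T hT _ => hT.zero M h
  quot M N h hN hq := fun T hT hST => hT.quot M N (h T hT hST) hN hq
  ext M hM N h1 h2 := fun T hT hST => hT.ext M hM N (h1 T hT hST) (h2 T hT hST)

theorem torfClosure_isTorsionFree [IsNoetherianRing A] (S : ModuleCat.{0} A → Prop)
    (hS : ∀ X, S X → Module.Finite A X) : IsTorsionFreeClass A (torfClosure A S) where
  fin M h := by
    refine h (fun X => Module.Finite A X) ⟨fun M h => h, fun M h => ?_, fun M N h hN _ => hN,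
      fun M hM N _ _ => hM⟩ hS
    have : Subsingleton M := ⟨fun x y => by rw [h x, h y]⟩
    infer_instance
  zero M h := fun T hT _ => hT.zero M h
  sub M N h hN hq := fun T hT hST => hT.sub M N (h T hT hST) hN hq
  ext M hM N h1 h2 := fun T hT hST => hT.ext M hM N (h1 T hT hST) (h2 T hT hST)

end Basics

section Covers
variable {A : Type} [Ring A] [IsArtinianRing A]
variable {T U : ModuleCat.{0} A → Prop}

theorem exists_min_brick (hT : IsTorsionClass A T) (hU : IsTorsionClass A U)
    (h : ∃ X, T X ∧ ¬ U X) :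
    ∃ B : ModuleCat.{0} A, T B ∧ rightPerp A U B ∧ Nonzero A B ∧
      ∀ X, T X → ∀ f : X →ₗ[A] B, f ≠ 0 → Function.Surjective f := by
  obtain ⟨X, hX, hXU⟩ := h
  obtain ⟨N, h1, h2⟩ := hU.exists_tors X (hT.fin X hX)
  have h3 : Nonzero A (ModuleCat.of A (X ⧸ N)) := by
    by_contra h3
    unfold Nonzero at h3
    push Not at h3
    refine hXU (hU.surj h1 N.subtype fun x => ?_)
    have : N.mkQ x = 0 := h3 _
    exact ⟨⟨x, by simpa using this⟩, rfl⟩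
  obtain ⟨B, ⟨hB1, hB2, hB3⟩, hmin⟩ := WellFounded.has_min
    (InvImage.wf (fun B : ModuleCat.{0} A => len B) (wellFounded_lt (α := ℕ)))
    {B | T B ∧ rightPerp A U B ∧ Nonzero A B} ⟨_, hT.quotient hX N, h2, h3⟩
  refine ⟨B, hB1, hB2, hB3, fun Y hY f hf => ?_⟩
  rw [← LinearMap.range_eq_top]
  by_contra hne
  have hfB := hT.fin B hB1
  refine hmin (ModuleCat.of A (LinearMap.range f)) ⟨hT.range hY f, ?_, ?_⟩
    (len_sub_lt B hfB _ hne)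
  · exact rightPerp_sub (inferInstanceAs (Module.Finite A (LinearMap.range f))) hB2
      (LinearMap.range f).subtype (Submodule.injective_subtype _)
  · by_contra h3
    unfold Nonzero at h3
    push Not at h3
    apply hf
    ext y
    exact congrArg Subtype.val (h3 ⟨f y, y, rfl⟩)

theorem brick_of_surj {B : ModuleCat.{0} A} (h1 : Module.Finite A B) (h2 : Nonzero A B)
    (h3 : ∀ f : B →ₗ[A] B, f ≠ 0 → Function.Surjective f) : IsBrick A B :=
  ⟨h1, h2, fun f hf => bij_of_surj_endo h1 f (h3 f hf)⟩

/-- `U` is a maximal proper torsion subclass of `T`. -/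
structure IsMaxBelow (T U : ModuleCat.{0} A → Prop) : Prop where
  tors : IsTorsionClass A U
  le : U ≤ T
  ne : U ≠ T
  max : ∀ V, IsTorsionClass A V → U ≤ V → V ≤ T → V = U ∨ V = T

/-- `B` is the brick label of `U ⋖ T`. -/
structure IsLabel (T U : ModuleCat.{0} A → Prop) (B : ModuleCat.{0} A) : Prop where
  mem : T B
  perp : rightPerp A U B
  nz : Nonzero A B
  surj : ∀ X, T X → ∀ f : X →ₗ[A] B, f ≠ 0 → Function.Surjective f
  ker : ∀ X, T X → ∀ f : X →ₗ[A] B, f ≠ 0 → T (ModuleCat.of A (LinearMap.ker f))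
  iff : ∀ X, T X → (U X ↔ ∀ f : X →ₗ[A] B, f = 0)

theorem exists_of_lt (h1 : U ≤ T) (h2 : U ≠ T) : ∃ X, T X ∧ ¬ U X := by
  by_contra h
  push Not at h
  exact h2 (le_antisymm h1 h)

theorem IsMaxBelow.exists_label (hT : IsTorsionClass A T) (h : IsMaxBelow T U) :
    ∃ B, IsLabel T U B := by
  obtain ⟨B, hB1, hB2, hB3, hB4⟩ := exists_min_brick hT h.tors (exists_of_lt h.le h.ne)
  have hfB := hT.fin B hB1
  obtain ⟨b0, hb0⟩ := hB3
  have hB5 : ∀ X, T X → (U X ↔ ∀ f : X →ₗ[A] B, f = 0) := by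
    have h1 := hT.perp B
    rcases h.max _ h1 (fun X hX => ⟨h.le X hX, fun f => hB2.2 X hX f⟩) (fun X hX => hX.1)
      with h2 | h2
    · intro X hX
      rw [← h2]
      exact ⟨fun h => h.2, fun h => ⟨hX, h⟩⟩
    · exfalso
      have h3 := hB1
      rw [← h2] at h3
      exact hb0 (LinearMap.congr_fun (h3.2 LinearMap.id) b0)
  refine ⟨B, hB1, hB2, ⟨b0, hb0⟩, hB4, fun X hX f hf => ?_, hB5⟩
  have hfX := hT.fin X hX
  let k := LinearMap.ker f
  obtain ⟨t, ht1, ht2⟩ := hT.exists_tors (ModuleCat.of A k) (inferInstanceAs (Module.Finite A k))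
  let tk : Submodule A X := Submodule.map k.subtype t
  have htk : T (ModuleCat.of A tk) :=
    hT.surj (X := ModuleCat.of A t) ht1 (Y := ModuleCat.of A tk)
      (k.subtype.submoduleMap t) (k.subtype.submoduleMap_surjective t)
  have htkle : tk ≤ k := Submodule.map_subtype_le _ _
  -- maps from `T` to `k / tk` vanish: phrase elementwise
  let fb : (X ⧸ tk) →ₗ[A] B := tk.liftQ f htkle
  have hfb : ∀ x, fb (tk.mkQ x) = f x := fun x => rfl
  have hkb : ∀ Z, T Z → ∀ g : Z →ₗ[A] (X ⧸ tk), fb ∘ₗ g = 0 → g = 0 := by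
    intro Z hZ g hg
    -- kernel of fb is isomorphic to k / t
    let i : (k ⧸ t) →ₗ[A] (X ⧸ tk) := t.liftQ (tk.mkQ ∘ₗ k.subtype) (by
      intro x hx
      rw [LinearMap.mem_ker]
      show tk.mkQ (x : X) = 0
      rw [Submodule.mkQ_apply, Submodule.Quotient.mk_eq_zero]
      exact ⟨x, hx, rfl⟩)
    have hi : Function.Injective i := by
      rw [← LinearMap.ker_eq_bot, eq_bot_iff]
      intro y hy
      obtain ⟨x, rfl⟩ := t.mkQ_surjective y
      have h1 : tk.mkQ (x : X) = 0 := hy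
      rw [Submodule.mkQ_apply, Submodule.Quotient.mk_eq_zero] at h1
      obtain ⟨z, hz, hzx⟩ := h1
      have : z = x := Subtype.ext hzx
      rw [← this]
      show t.mkQ z = 0
      rw [Submodule.mkQ_apply, Submodule.Quotient.mk_eq_zero]
      exact hz
    have hri : ∀ z, g z ∈ LinearMap.range i := by
      intro z
      obtain ⟨x, hx⟩ := tk.mkQ_surjective (g z)
      have h1 : f x = 0 := by
        rw [← hfb, hx]; exact LinearMap.congr_fun hg z
      exact ⟨t.mkQ ⟨x, h1⟩, hx⟩
    let e := LinearEquiv.ofInjective i hi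
    have h1 := ht2.2 Z hZ (e.symm.toLinearMap ∘ₗ g.codRestrict _ hri)
    ext z
    have h2 : e.symm ((g.codRestrict _ hri) z) = 0 := LinearMap.congr_fun h1 z
    have h3 : (g.codRestrict _ hri) z = 0 := by simpa using h2
    exact congrArg Subtype.val h3
  -- nonzero map h : B → X/tk
  have hXb := hT.quotient hX tk
  have hex : ∃ h : B →ₗ[A] (X ⧸ tk), h ≠ 0 := by
    by_contra hno
    push Not at hno
    have h1 := hT.perp (ModuleCat.of A (X ⧸ tk))
    rcases h.max _ h1 (fun Z hZ => ⟨h.le Z hZ, fun g => hkb Z (h.le Z hZ) g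
      (hB2.2 Z hZ (fb ∘ₗ g))⟩) (fun X hX => hX.1) with h2 | h2
    · have h3 : U B := by rw [← h2]; exact ⟨hB1, hno⟩
      exact hb0 (zero_of_perp h3 hB2 b0)
    · have h3 := hXb
      rw [← h2] at h3
      have h4 := h3.2 LinearMap.id
      apply hf
      ext x
      rw [← hfb]
      have : tk.mkQ x = 0 := LinearMap.congr_fun h4 (tk.mkQ x)
      rw [this]; simp
  obtain ⟨h, hh⟩ := hex
  have hne : fb ∘ₗ h ≠ 0 := fun h0 => hh (hkb B hB1 h h0)
  have hbij := bij_of_surj_endo hfB _ (hB4 B hB1 (fb ∘ₗ h) hne)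
  let e := LinearEquiv.ofBijective _ hbij
  have hz := hkb _ hXb (LinearMap.id - h ∘ₗ e.symm.toLinearMap ∘ₗ fb) (by
    ext x
    show fb (_ - h (e.symm (fb _))) = 0
    rw [map_sub, sub_eq_zero]
    exact (e.apply_symm_apply (fb (tk.mkQ x))).symm)
  have hke : k = tk := by
    apply le_antisymm _ htkle
    intro x hx
    have h1 : tk.mkQ x - h (e.symm (fb (tk.mkQ x))) = 0 := LinearMap.congr_fun hz (tk.mkQ x)
    have h2 : f x = 0 := hx
    rw [hfb, h2] at h1
    rw [← Submodule.Quotient.mk_eq_zero]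
    simpa using h1
  show T (ModuleCat.of A k)
  rw [hke]; exact htk

theorem IsLabel.brick (hT : IsTorsionClass A T) {B} (h : IsLabel T U B) : IsBrick A B :=
  brick_of_surj (hT.fin _ h.mem) h.nz (h.surj B h.mem)

theorem IsLabel.orth (hT : IsTorsionClass A T) {U' : ModuleCat.{0} A → Prop}
    (hU : IsMaxBelow T U) (hU' : IsMaxBelow T U') (hne : U ≠ U')
    {B B'} (h : IsLabel T U B) (h' : IsLabel T U' B') (f : B →ₗ[A] B') : f = 0 := by
  by_contra hf
  have hs := h'.surj B h.mem f hf
  have hk := h'.ker B h.mem f hf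
  have hi : Function.Injective f := by
    rw [← LinearMap.ker_eq_bot]
    by_contra hk0
    have h1 : (LinearMap.ker f).subtype ≠ 0 := by
      intro h0
      apply hk0
      rw [eq_bot_iff]
      intro x hx
      exact LinearMap.congr_fun h0 ⟨x, hx⟩
    have h2 := h.surj _ hk (LinearMap.ker f).subtype h1
    apply hf
    ext x
    obtain ⟨y, rfl⟩ := h2 x
    exact y.2
  let e := LinearEquiv.ofBijective f ⟨hi, hs⟩
  apply hne
  funext X
  apply propext
  constructor
  · intro hX
    rw [h'.iff X (hU.le X hX)]
    intro g
    have := (h.iff X (hU.le X hX)).1 hX (e.symm.toLinearMap ∘ₗ g)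
    ext x
    have h3 : e.symm (g x) = 0 := LinearMap.congr_fun this x
    simpa using h3
  · intro hX
    rw [h.iff X (hU'.le X hX)]
    intro g
    have := (h'.iff X (hU'.le X hX)).1 hX (f ∘ₗ g)
    ext x
    apply hi
    simpa using LinearMap.congr_fun this x

/-- `T` is generated by a single module through factors of finite powers. -/
def IsFac (T : ModuleCat.{0} A → Prop) : Prop :=
  ∃ M : ModuleCat.{0} A, T M ∧ ∀ X, T X → ∃ (n : ℕ) (f : (Fin n → M) →ₗ[A] X),
    Function.Surjective f

theorem IsFac.zero_of {M X : ModuleCat.{0} A} {B : Type} [AddCommGroup B] [Module A B]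
    {n : ℕ} (f : (Fin n → M) →ₗ[A] X)
    (hf : Function.Surjective f) (g : X →ₗ[A] B) (h : ∀ g : M →ₗ[A] B, g = 0) : g = 0 := by
  have h1 : g ∘ₗ f = 0 := by
    apply LinearMap.pi_ext'
    intro i
    rw [LinearMap.zero_comp]
    exact h _
  ext x
  obtain ⟨y, rfl⟩ := hf x
  exact LinearMap.congr_fun h1 y

theorem IsFac.le_of_mem {M : ModuleCat.{0} A} {V : ModuleCat.{0} A → Prop}
    (hM : ∀ X, T X → ∃ (n : ℕ) (f : (Fin n → M) →ₗ[A] X), Function.Surjective f)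
    (hV : IsTorsionClass A V) (h : V M) : T ≤ V := by
  intro X hX
  obtain ⟨n, f, hf⟩ := hM X hX
  exact hV.surj (hV.pi h n) f hf

theorem finite_max (hT : IsTorsionClass A T) (hfac : IsFac T) :
    {U | IsMaxBelow T U}.Finite := by
  classical
  obtain ⟨M, hM, hgen⟩ := hfac
  have hfM := hT.fin M hM
  by_contra hinf
  have key : ∀ s : Finset (ModuleCat.{0} A → Prop), (∀ U ∈ s, IsMaxBelow T U) →
      ∃ k : Submodule A M, T (ModuleCat.of A k) ∧ len (ModuleCat.of A k) + s.card ≤ len M ∧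
        ∀ U, IsMaxBelow T U → U ∉ s → ∀ B, IsLabel T U B → ∃ f : k →ₗ[A] B, f ≠ 0 := by
    intro s
    induction s using Finset.induction_on with
    | empty =>
      intro _
      refine ⟨⊤, ?_, ?_, ?_⟩
      · exact hT.surj (Y := ModuleCat.of A (⊤ : Submodule A M)) hM Submodule.topEquiv.symm.toLinearMap
          Submodule.topEquiv.symm.surjective
      · rw [Finset.card_empty, add_zero]
        exact le_of_eq (len_eq_of_equiv (X := ModuleCat.of A (⊤ : Submodule A M)) Submodule.topEquiv)
      · intro U hU _ B hB
        by_contra hno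
        push Not at hno
        obtain ⟨n, f, hf⟩ := hgen B hB.mem
        have := IsFac.zero_of f hf LinearMap.id (fun g => by
          have := hno (g ∘ₗ (Submodule.subtype _))
          ext x
          exact LinearMap.congr_fun this ⟨x, trivial⟩)
        obtain ⟨b, hb⟩ := hB.nz
        exact hb (LinearMap.congr_fun this b)
    | insert U s hUs ih =>
      intro hs
      obtain ⟨k, hk1, hk2, hk3⟩ := ih (fun V hV => hs V (Finset.mem_insert_of_mem hV))
      have hU := hs U (Finset.mem_insert_self _ _)
      obtain ⟨B, hB⟩ := hU.exists_label hT
      obtain ⟨f, hf⟩ := hk3 U hU hUs B hB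
      have hkT := hB.ker (ModuleCat.of A k) hk1 f hf
      let k' : Submodule A M := Submodule.map k.subtype (LinearMap.ker f)
      let e : (LinearMap.ker f) ≃ₗ[A] k' :=
        Submodule.equivMapOfInjective k.subtype (Submodule.injective_subtype k) (LinearMap.ker f)
      refine ⟨k', hT.surj (Y := ModuleCat.of A k') hkT e.toLinearMap e.surjective, ?_, ?_⟩
      · have h1 : len (ModuleCat.of A (LinearMap.ker f)) < len (ModuleCat.of A k) := by
          apply len_sub_lt (ModuleCat.of A k) (hT.fin _ hk1)
          intro h
          exact hf (LinearMap.ker_eq_top.1 h)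
        have h2 : len (ModuleCat.of A (LinearMap.ker f)) = len (ModuleCat.of A k') :=
          len_eq_of_equiv (X := ModuleCat.of A (LinearMap.ker f)) (Y := ModuleCat.of A k') e
        rw [Finset.card_insert_of_notMem hUs]
        omega
      · intro V hV hVs B' hB'
        rw [Finset.mem_insert, not_or] at hVs
        obtain ⟨g, hg⟩ := hk3 V hV hVs.2 B' hB'
        by_contra hno
        push Not at hno
        -- g vanishes on ker f so factors through B
        apply hg
        have h1 : LinearMap.ker f ≤ LinearMap.ker g := by
          intro x hx
          have := LinearMap.congr_fun (hno (g ∘ₗ (LinearMap.ker f).subtype ∘ₗ e.symm.toLinearMap))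
            (e ⟨x, hx⟩)
          simpa using this
        have hs' := hB.surj (ModuleCat.of A k) hk1 f hf
        let q := f.quotKerEquivOfSurjective hs'
        have h2 := IsLabel.orth hT hU hV (fun h => hVs.1 h.symm) hB hB'
          ((LinearMap.ker f).liftQ g h1 ∘ₗ q.symm.toLinearMap)
        ext x
        have h3 := LinearMap.congr_fun h2 (f x)
        have h4 : q.symm (f x) = (LinearMap.ker f).mkQ x := by
          rw [LinearEquiv.symm_apply_eq]; rfl
        simp only [LinearMap.comp_apply, LinearEquiv.coe_coe, h4] at h3
        simpa using h3
  obtain ⟨s, hs, hcard⟩ := Set.Infinite.exists_subset_card_eq hinf (len M + 1)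
  obtain ⟨k, _, h2, _⟩ := key s (fun U hU => hs hU)
  omega

theorem isTorsion_sUnion {c : Set (ModuleCat.{0} A → Prop)} (hc : IsChain (· ≤ ·) c)
    (hne : c.Nonempty) (h : ∀ U ∈ c, IsTorsionClass A U) :
    IsTorsionClass A (fun X => ∃ U ∈ c, U X) where
  fin := by rintro M ⟨U, hU, hM⟩; exact (h U hU).fin M hM
  zero M hM := by obtain ⟨U, hU⟩ := hne; exact ⟨U, hU, (h U hU).zero M hM⟩
  quot := by rintro M N ⟨U, hU, hM⟩ hN hq; exact ⟨U, hU, (h U hU).quot M N hM hN hq⟩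
  ext := by
    rintro M hM N ⟨U, hU, h1⟩ ⟨V, hV, h2⟩
    rcases hc.total hU hV with hle | hle
    · exact ⟨V, hV, (h V hV).ext M hM N (hle _ h1) h2⟩
    · exact ⟨U, hU, (h U hU).ext M hM N h1 (hle _ h2)⟩

theorem exists_max (hT : IsTorsionClass A T) (hfac : IsFac T) (hU : IsTorsionClass A U)
    (hle : U ≤ T) (hne : U ≠ T) : ∃ V, IsMaxBelow T V ∧ U ≤ V := by
  obtain ⟨M, hM, hgen⟩ := hfac
  have hUM : ¬ U M := fun h => hne (le_antisymm hle (IsFac.le_of_mem hgen hU h))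
  obtain ⟨V, hUV, hV⟩ := zorn_le_nonempty₀ {V | IsTorsionClass A V ∧ V ≤ T ∧ ¬ V M} (by
    intro c hcS hc y hy
    refine ⟨fun X => ∃ U ∈ c, U X, ⟨isTorsion_sUnion hc ⟨y, hy⟩ (fun U hU => (hcS hU).1), ?_, ?_⟩, ?_⟩
    · rintro X ⟨U, hU, hX⟩
      exact (hcS hU).2.1 X hX
    · rintro ⟨U, hU, hX⟩
      exact (hcS hU).2.2 hX
    · intro U hU X hX
      exact ⟨U, hU, hX⟩) U ⟨hU, hle, hUM⟩
  refine ⟨V, ⟨hV.prop.1, hV.prop.2.1, ?_, ?_⟩, hUV⟩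
  · rintro rfl
    exact hV.prop.2.2 hM
  · intro W hW h1 h2
    by_cases hWM : W M
    · right
      exact le_antisymm h2 (IsFac.le_of_mem hgen hW hWM)
    · left
      exact le_antisymm (hV.le_of_ge ⟨hW, h2, hWM⟩ h1) h1

end Covers

section TL
variable {A : Type} [Ring A]

theorem exists_scalar_gen (K : Type) [Field K] [Algebra K A] [FiniteDimensional K A]
    (M : Type) [AddCommGroup M] [Module A M] [Module.Finite A M] :
    ∃ (d : ℕ) (b : Fin d → M), ∀ m : M, ∃ φ : (Fin d → M) →ₗ[A] M, φ b = m := by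
  letI : Module K M := Module.compHom M (algebraMap K A)
  haveI : IsScalarTower K A M := IsScalarTower.of_algebraMap_smul fun r x => rfl
  haveI : Module.Finite K M := Module.Finite.trans A M
  obtain ⟨d, b, hb⟩ := Module.Finite.exists_fin (R := K) (M := M)
  refine ⟨d, b, fun m => ?_⟩
  have hm : m ∈ Submodule.span K (Set.range b) := by rw [hb]; trivial
  rw [Submodule.mem_span_range_iff_exists_fun] at hm
  obtain ⟨c, hc⟩ := hm
  haveI : SMulCommClass K A M := IsScalarTower.to_smulCommClass
  haveI : SMulCommClass A K M := SMulCommClass.symm _ _ _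
  refine ⟨∑ i, c i • LinearMap.proj i, ?_⟩
  rw [← hc]
  simp

theorem exists_orbit_min (K : Type) [Field K] [Algebra K A] [FiniteDimensional K A]
    (P Y : Type) [AddCommGroup P] [Module A P] [Module.Finite A P]
    [AddCommGroup Y] [Module A Y] [Module.Finite A Y] (h : ∃ g : P →ₗ[A] Y, g ≠ 0) :
    ∃ g : P →ₗ[A] Y, g ≠ 0 ∧ ∀ s : P →ₗ[A] P, g ∘ₗ s ≠ 0 → ∃ t : P →ₗ[A] P,
      g ∘ₗ s ∘ₗ t = g := by
  letI : Module K P := Module.compHom P (algebraMap K A)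
  haveI : IsScalarTower K A P := IsScalarTower.of_algebraMap_smul fun r x => rfl
  haveI : Module.Finite K P := Module.Finite.trans A P
  letI : Module K Y := Module.compHom Y (algebraMap K A)
  haveI : IsScalarTower K A Y := IsScalarTower.of_algebraMap_smul fun r x => rfl
  haveI : Module.Finite K Y := Module.Finite.trans A Y
  haveI : SMulCommClass K A P := IsScalarTower.to_smulCommClass
  haveI : SMulCommClass A K P := SMulCommClass.symm _ _ _
  haveI : SMulCommClass K A Y := IsScalarTower.to_smulCommClass
  haveI : SMulCommClass A K Y := SMulCommClass.symm _ _ _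
  haveI : Module.Finite K (P →ₗ[A] Y) :=
    Module.Finite.of_injective (LinearMap.restrictScalarsₗ K A P Y K)
      (LinearMap.restrictScalars_injective K)
  let W : (P →ₗ[A] Y) → Submodule K (P →ₗ[A] Y) := fun g =>
    { carrier := {x | ∃ s : P →ₗ[A] P, x = g ∘ₗ s}
      add_mem' := by
        rintro _ _ ⟨s, rfl⟩ ⟨t, rfl⟩
        exact ⟨s + t, (LinearMap.comp_add _ _ _).symm⟩
      zero_mem' := ⟨0, (LinearMap.comp_zero _).symm⟩
      smul_mem' := by
        rintro c _ ⟨s, rfl⟩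
        refine ⟨c • s, ?_⟩
        ext x
        show c • g (s x) = g (c • s x)
        rw [← algebraMap_smul A c (s x), map_smul, algebraMap_smul] }
  obtain ⟨g, hg, hmin⟩ := WellFounded.has_min
    (InvImage.wf W (wellFounded_lt (α := Submodule K (P →ₗ[A] Y)))) {g | g ≠ 0} h
  refine ⟨g, hg, fun s hs => ?_⟩
  have hle : W (g ∘ₗ s) ≤ W g := by
    rintro _ ⟨t, rfl⟩
    exact ⟨s ∘ₗ t, rfl⟩
  have heq : W (g ∘ₗ s) = W g := by
    by_contra hne
    exact hmin _ hs (lt_of_le_of_ne hle hne)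
  have hgm : g ∈ W (g ∘ₗ s) := by rw [heq]; exact ⟨LinearMap.id, rfl⟩
  obtain ⟨t, ht⟩ := hgm
  exact ⟨t, ht.symm⟩

variable [IsArtinianRing A]
variable {T U : ModuleCat.{0} A → Prop}

/-- Minimal left `T`-approximation of the regular module. -/
structure Appr (T : ModuleCat.{0} A → Prop) (N : ModuleCat.{0} A) (n0 : N) : Prop where
  mem : T N
  gen : ∀ Y : ModuleCat.{0} A, T Y → ∀ y : Y, ∃ h : N →ₗ[A] Y, h n0 = y
  bij : ∀ e : N →ₗ[A] N, e n0 = n0 → Function.Bijective e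

theorem exists_appr (K : Type) [Field K] [Algebra K A] [FiniteDimensional K A]
    (hT : IsTorsionClass A T) (hfac : IsFac T) : ∃ N n0, Appr T N n0 := by
  obtain ⟨M, hM, hgen⟩ := hfac
  have hfM := hT.fin M hM
  obtain ⟨d, b, hb⟩ := exists_scalar_gen (A := A) K M
  have hex : ∃ N : ModuleCat.{0} A, T N ∧ ∃ n0 : N, ∀ Y : ModuleCat.{0} A, T Y → ∀ y : Y,
      ∃ h : N →ₗ[A] Y, h n0 = y := by
    refine ⟨ModuleCat.of A (Fin d → M), hT.pi hM d, b, fun Y hY y => ?_⟩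
    obtain ⟨n, f, hf⟩ := hgen Y hY
    obtain ⟨m, rfl⟩ := hf y
    choose φ hφ using fun j => hb (m j)
    refine ⟨f ∘ₗ LinearMap.pi φ, ?_⟩
    show f (fun j => φ j b) = f m
    congr 1
    funext j
    exact hφ j
  obtain ⟨N, ⟨hN, n0, hgN⟩, hmin⟩ := WellFounded.has_min
    (InvImage.wf (fun B : ModuleCat.{0} A => len B) (wellFounded_lt (α := ℕ))) _ hex
  have hfN := hT.fin N hN
  refine ⟨N, n0, hN, hgN, fun e he => ?_⟩
  apply bij_of_surj_endo hfN
  rw [← LinearMap.range_eq_top]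
  by_contra hne
  refine hmin (ModuleCat.of A (LinearMap.range e)) ⟨hT.range hN e, ⟨n0, n0, he⟩, ?_⟩
    (len_sub_lt N hfN _ hne)
  intro Y hY y
  obtain ⟨h, hh⟩ := hgN Y hY y
  exact ⟨h ∘ₗ (LinearMap.range e).subtype, hh⟩

/-- `P` lifts along surjections in `T` with kernel in `T`. -/
def EP (T : ModuleCat.{0} A → Prop) (P : ModuleCat.{0} A) : Prop :=
  ∀ X Z : ModuleCat.{0} A, T X → ∀ p : X →ₗ[A] Z, Function.Surjective p →
    T (ModuleCat.of A (LinearMap.ker p)) → ∀ g : P →ₗ[A] Z, ∃ h : P →ₗ[A] X, p ∘ₗ h = g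

theorem EP.retract {P Q : ModuleCat.{0} A} (h : EP T P) (i : Q →ₗ[A] P) (r : P →ₗ[A] Q)
    (hr : r ∘ₗ i = LinearMap.id) : EP T Q := by
  intro X Z hX p hp hk g
  obtain ⟨l, hl⟩ := h X Z hX p hp hk (g ∘ₗ r)
  refine ⟨l ∘ₗ i, ?_⟩
  rw [← LinearMap.comp_assoc, hl, LinearMap.comp_assoc, hr, LinearMap.comp_id]

variable {N : ModuleCat.{0} A} {n0 : N}

theorem Appr.epL (hT : IsTorsionClass A T) (hN : Appr T N n0) :
    EP T (ModuleCat.of A (N ⧸ Submodule.span A {n0})) := by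
  intro X Z hX p hp hk g
  let q := (Submodule.span A {n0}).mkQ
  have hq0 : q n0 = 0 := by
    show Submodule.Quotient.mk n0 = _
    rw [Submodule.Quotient.mk_eq_zero]
    exact Submodule.mem_span_singleton_self n0
  let D : (N × X) →ₗ[A] Z := g ∘ₗ q ∘ₗ LinearMap.fst A N X - p ∘ₗ LinearMap.snd A N X
  let E := LinearMap.ker D
  have hmemE : ∀ n x, (n, x) ∈ E ↔ g (q n) = p x := by
    intro n x
    show g (q n) - p x = 0 ↔ _
    exact sub_eq_zero
  have hE : T (ModuleCat.of A E) := by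
    let f : E →ₗ[A] N := LinearMap.fst A N X ∘ₗ E.subtype
    refine hT.of_ker (X := ModuleCat.of A E) (Y := N) f ?_ ?_
    · refine hT.surj (X := ModuleCat.of A (LinearMap.ker p)) hk
        (Y := ModuleCat.of A (LinearMap.ker f))
        (LinearMap.codRestrict _ (LinearMap.codRestrict E
          (LinearMap.inr A N X ∘ₗ (LinearMap.ker p).subtype) ?_) ?_) ?_
      · rintro ⟨x, hx⟩
        show ((0 : N), x) ∈ E
        rw [hmemE, hx, map_zero, map_zero]
      · intro x
        rfl
      · rintro ⟨⟨⟨n, x⟩, h1⟩, h2⟩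
        have h2' : n = 0 := h2
        subst h2'
        rw [hmemE, map_zero, map_zero] at h1
        exact ⟨⟨x, h1.symm⟩, rfl⟩
    · refine hT.surj hN.mem (Y := ModuleCat.of A (LinearMap.range f))
        (LinearMap.codRestrict _ LinearMap.id ?_) ?_
      · intro n
        obtain ⟨x, hx⟩ := hp (g (q n))
        exact ⟨⟨(n, x), (hmemE n x).2 hx.symm⟩, rfl⟩
      · rintro ⟨n, hn⟩
        exact ⟨n, rfl⟩
  obtain ⟨s, hs⟩ := hN.gen _ hE ⟨(n0, 0), by rw [hmemE, hq0, map_zero, map_zero]⟩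
  have hs' : (s n0).1 = (n0, 0) := congrArg Subtype.val hs
  have hbij := hN.bij (LinearMap.fst A N X ∘ₗ E.subtype ∘ₗ s) (by
    show (s n0).1.1 = n0
    rw [hs'])
  let e := LinearEquiv.ofBijective _ hbij
  have he0 : e.symm n0 = n0 := by
    rw [LinearEquiv.symm_apply_eq]
    show n0 = (s n0).1.1
    rw [hs']
  let l : N →ₗ[A] X := LinearMap.snd A N X ∘ₗ E.subtype ∘ₗ s ∘ₗ e.symm.toLinearMap
  have hl : Submodule.span A {n0} ≤ LinearMap.ker l := by
    rw [Submodule.span_singleton_le_iff_mem, LinearMap.mem_ker]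
    show (s (e.symm n0)).1.2 = 0
    rw [he0, hs']
  refine ⟨(Submodule.span A {n0}).liftQ l hl, ?_⟩
  apply LinearMap.ext
  intro y
  obtain ⟨n, rfl⟩ := (Submodule.span A {n0}).mkQ_surjective y
  show p (s (e.symm n)).1.2 = g (q n)
  have h1 := (hmemE (s (e.symm n)).1.1 (s (e.symm n)).1.2).1 (s (e.symm n)).2
  rw [← h1]
  have h2 : (s (e.symm n)).1.1 = n := e.apply_symm_apply n
  rw [h2]

/-- factor through the quotient by `n0` -/
theorem exists_factor {Y : ModuleCat.{0} A} (g : N →ₗ[A] Y) (h : g n0 = 0) :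
    ∃ g' : (N ⧸ Submodule.span A {n0}) →ₗ[A] Y, g' ∘ₗ (Submodule.span A {n0}).mkQ = g :=
  ⟨(Submodule.span A {n0}).liftQ g (by
    rw [Submodule.span_singleton_le_iff_mem]; exact h), Submodule.liftQ_mkQ _ _ _⟩

theorem Appr.epN (hT : IsTorsionClass A T) (hN : Appr T N n0) : EP T N := by
  intro X Z hX p hp hk g
  obtain ⟨x, hx⟩ := hp (g n0)
  obtain ⟨h, hh⟩ := hN.gen X hX x
  obtain ⟨g', hg'⟩ := exists_factor (n0 := n0) (g - p ∘ₗ h) (by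
    rw [LinearMap.sub_apply, LinearMap.comp_apply, hh, hx, sub_self])
  obtain ⟨l, hl⟩ := hN.epL hT X Z hX p hp hk g'
  refine ⟨h + l ∘ₗ (Submodule.span A {n0}).mkQ, ?_⟩
  rw [LinearMap.comp_add, ← LinearMap.comp_assoc, hl, hg']
  abel

/-- Minimal projective cover of the label. -/
structure Prj (T : ModuleCat.{0} A → Prop) (B P : ModuleCat.{0} A) (a : P →ₗ[A] B) : Prop where
  mem : T P
  ep : EP T P
  ne : a ≠ 0
  bij : ∀ u : P →ₗ[A] P, a ∘ₗ u = a → Function.Bijective u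

theorem exists_prj (hT : IsTorsionClass A T) (hN : Appr T N n0) {B : ModuleCat.{0} A}
    (hB : IsLabel T U B) : ∃ P a, Prj T B P a := by
  obtain ⟨b, hb⟩ := hB.nz
  obtain ⟨h, hh⟩ := hN.gen B hB.mem b
  obtain ⟨P, ⟨hP, hEP, a, ha⟩, hmin⟩ := WellFounded.has_min
    (InvImage.wf (fun B : ModuleCat.{0} A => len B) (wellFounded_lt (α := ℕ)))
    {P | T P ∧ EP T P ∧ ∃ a : P →ₗ[A] B, a ≠ 0}
    ⟨N, hN.mem, hN.epN hT, h, fun h0 => hb (by rw [← hh, h0]; rfl)⟩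
  have hfP := hT.fin P hP
  refine ⟨P, a, hP, hEP, ha, fun u hu => ?_⟩
  apply bij_of_surj_endo hfP
  obtain ⟨n, hn, hc⟩ := ((Filter.eventually_ge_atTop 1).and
    (LinearMap.eventually_isCompl_ker_pow_range_pow u)).exists
  have hpow : ∀ k x, a ((u ^ k) x) = a x := by
    intro k
    induction k with
    | zero => intro x; rfl
    | succ k ih =>
      intro x
      rw [pow_succ, Module.End.mul_apply, ih]
      exact LinearMap.congr_fun hu x
  have htop : LinearMap.range (u ^ n) = ⊤ := by
    by_contra hne
    refine hmin (ModuleCat.of A (LinearMap.range (u ^ n))) ⟨hT.range hP (u ^ n), ?_, ?_⟩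
      (len_sub_lt P hfP _ hne)
    · refine hEP.retract (Q := ModuleCat.of A (LinearMap.range (u ^ n)))
        (LinearMap.range (u ^ n)).subtype
        (Submodule.linearProjOfIsCompl _ _ hc.symm) ?_
      apply LinearMap.ext
      intro x
      exact Submodule.linearProjOfIsCompl_apply_left hc.symm x
    · refine ⟨a ∘ₗ (LinearMap.range (u ^ n)).subtype, fun h0 => ha ?_⟩
      ext x
      rw [← hpow n x]
      exact LinearMap.congr_fun h0 ⟨(u ^ n) x, x, rfl⟩
  intro y
  obtain ⟨x, hx⟩ := LinearMap.range_eq_top.1 htop y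
  obtain ⟨m, rfl⟩ : ∃ m, n = m + 1 := ⟨n - 1, by omega⟩
  rw [pow_succ'] at hx
  exact ⟨(u ^ m) x, hx⟩

variable {B P : ModuleCat.{0} A} {a : P →ₗ[A] B}

theorem homLB (hT : IsTorsionClass A T) (hN : Appr T N n0) (hB : IsLabel T U B)
    (hP : Prj T B P a) (b : (N ⧸ Submodule.span A {n0}) →ₗ[A] B) : b = 0 := by
  by_contra hb
  let q := (Submodule.span A {n0}).mkQ
  have hq0 : q n0 = 0 := by
    show Submodule.Quotient.mk n0 = _
    rw [Submodule.Quotient.mk_eq_zero]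
    exact Submodule.mem_span_singleton_self n0
  have hqs : Function.Surjective q := (Submodule.span A {n0}).mkQ_surjective
  have hbq : b ∘ₗ q ≠ 0 := by
    intro h0
    apply hb
    apply LinearMap.ext
    intro y
    obtain ⟨n, rfl⟩ := hqs y
    exact LinearMap.congr_fun h0 n
  obtain ⟨j, hj⟩ := hP.ep N B hN.mem (b ∘ₗ q) (hB.surj N hN.mem _ hbq) (hB.ker N hN.mem _ hbq) a
  obtain ⟨c, hc⟩ := hN.epL hT P B hP.mem a (hB.surj P hP.mem a hP.ne) (hB.ker P hP.mem a hP.ne) b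
  have hc' : ∀ y, a (c y) = b y := fun y => LinearMap.congr_fun hc y
  have hj' : ∀ y, b (q (j y)) = a y := fun y => LinearMap.congr_fun hj y
  have hw := hP.bij (c ∘ₗ q ∘ₗ j) (by
    ext y
    show a (c (q (j y))) = a y
    rw [hc', hj'])
  let w := LinearEquiv.ofBijective _ hw
  have he := hN.bij (LinearMap.id - j ∘ₗ w.symm.toLinearMap ∘ₗ c ∘ₗ q) (by
    show n0 - j (w.symm (c (q n0))) = n0
    rw [hq0, map_zero, map_zero, map_zero, sub_zero])
  apply hbq
  ext n
  obtain ⟨m, rfl⟩ := he.2 n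
  show b (q (m - j (w.symm (c (q m))))) = 0
  have h1 : c (q (m - j (w.symm (c (q m))))) = 0 := by
    rw [map_sub, map_sub, sub_eq_zero]
    exact (w.apply_symm_apply (c (q m))).symm
  rw [← hc', h1, map_zero]

theorem decomp (hT : IsTorsionClass A T) (hB : IsLabel T U B) (hP : Prj T B P a) :
    ∀ (n : ℕ) (X : ModuleCat.{0} A), len X = n → T X → EP T X →
      ∃ V : ModuleCat.{0} A, T V ∧ EP T V ∧ (∀ f : V →ₗ[A] B, f = 0) ∧
        ∀ (Z Y : ModuleCat.{0} A) (g : Z →ₗ[A] Y), (∀ v : V →ₗ[A] Z, g ∘ₗ v = 0) →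
          (∀ p : P →ₗ[A] Z, g ∘ₗ p = 0) → ∀ x : X →ₗ[A] Z, g ∘ₗ x = 0 := by
  intro n
  induction n using Nat.strong_induction_on with
  | _ n ih =>
  intro X hn hX hEP
  by_cases h0 : ∀ f : X →ₗ[A] B, f = 0
  · exact ⟨X, hX, hEP, h0, fun Z Y g h1 _ => h1⟩
  push Not at h0
  obtain ⟨b, hb⟩ := h0
  have hfX := hT.fin X hX
  obtain ⟨j, hj⟩ := hP.ep X B hX b (hB.surj X hX b hb) (hB.ker X hX b hb) a
  obtain ⟨c, hc⟩ := hEP P B hP.mem a (hB.surj P hP.mem a hP.ne) (hB.ker P hP.mem a hP.ne) b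
  have hc' : ∀ y, a (c y) = b y := fun y => LinearMap.congr_fun hc y
  have hj' : ∀ y, b (j y) = a y := fun y => LinearMap.congr_fun hj y
  have hw := hP.bij (c ∘ₗ j) (by
    ext y
    show a (c (j y)) = a y
    rw [hc', hj'])
  let w := LinearEquiv.ofBijective _ hw
  let π : X →ₗ[A] LinearMap.ker c :=
    LinearMap.codRestrict _ (LinearMap.id - j ∘ₗ w.symm.toLinearMap ∘ₗ c) (by
      intro x
      show c (x - j (w.symm (c x))) = 0
      rw [map_sub, sub_eq_zero]
      exact (w.apply_symm_apply (c x)).symm)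
  have hπ : π ∘ₗ (LinearMap.ker c).subtype = LinearMap.id := by
    apply LinearMap.ext
    rintro ⟨x, hx⟩
    apply Subtype.ext
    show x - j (w.symm (c x)) = x
    have hx' : c x = 0 := hx
    rw [hx', map_zero, map_zero, sub_zero]
  have hπs : Function.Surjective π := fun y => ⟨y.1, LinearMap.congr_fun hπ y⟩
  have hlt : len (ModuleCat.of A (LinearMap.ker c)) < n := by
    rw [← hn]
    apply len_sub_lt X hfX
    intro h
    apply hb
    rw [← hc, LinearMap.ker_eq_top.1 h, LinearMap.comp_zero]
  obtain ⟨V, hV1, hV2, hV3, hV4⟩ := ih _ hlt (ModuleCat.of A (LinearMap.ker c)) rfl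
    (hT.surj (Y := ModuleCat.of A (LinearMap.ker c)) hX π hπs)
    (hEP.retract (Q := ModuleCat.of A (LinearMap.ker c)) (LinearMap.ker c).subtype π hπ)
  refine ⟨V, hV1, hV2, hV3, fun Z Y g h1 h2 x => ?_⟩
  have h3 := hV4 Z Y g h1 h2 (x ∘ₗ (LinearMap.ker c).subtype)
  have h4 := h2 (x ∘ₗ j)
  ext y
  have h5 : g (x (π y).1) = 0 := LinearMap.congr_fun h3 (π y)
  have h6 : g (x (j (w.symm (c y)))) = 0 := LinearMap.congr_fun h4 (w.symm (c y))
  have h7 : y = (π y).1 + j (w.symm (c y)) := by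
    show y = (y - j (w.symm (c y))) + j (w.symm (c y))
    rw [sub_add_cancel]
  show g (x y) = 0
  rw [h7, map_add, map_add, h5, h6, add_zero]

theorem claim (K : Type) [Field K] [Algebra K A] [FiniteDimensional K A]
    (hT : IsTorsionClass A T) (hU : IsMaxBelow T U) (hN : Appr T N n0)
    (hB : IsLabel T U B) (hP : Prj T B P a) {V : ModuleCat.{0} A} (hV : EP T V)
    (hdec : ∀ (Z Y : ModuleCat.{0} A) (g : Z →ₗ[A] Y), (∀ v : V →ₗ[A] Z, g ∘ₗ v = 0) →
          (∀ p : P →ₗ[A] Z, g ∘ₗ p = 0) → ∀ x : N →ₗ[A] Z, g ∘ₗ x = 0) :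
    ∀ (n : ℕ) (Y : ModuleCat.{0} A), len Y = n → U Y → (∀ v : V →ₗ[A] Y, v = 0) →
      (∀ l : (N ⧸ Submodule.span A {n0}) →ₗ[A] Y, l = 0) → ∀ y : Y, y = 0 := by
  intro n
  induction n using Nat.strong_induction_on with
  | _ n ih =>
  intro Y hn hY hVY hLY
  by_contra hne
  push Not at hne
  obtain ⟨y, hy⟩ := hne
  have hTY := hU.le Y hY
  have hfY := hT.fin Y hTY
  have hfP := hT.fin P hP.mem
  have hex : ∃ g : P →ₗ[A] Y, g ≠ 0 := by
    by_contra hno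
    push Not at hno
    obtain ⟨h, hh⟩ := hN.gen Y hTY y
    have := hdec Y Y LinearMap.id (fun v => by rw [hVY v, LinearMap.comp_zero])
      (fun p => by rw [hno p, LinearMap.comp_zero]) h
    apply hy
    rw [← hh]
    exact LinearMap.congr_fun this n0
  obtain ⟨g, hg, horb⟩ := exists_orbit_min K P Y hex
  have hak := hB.ker P hP.mem a hP.ne
  have has := hB.surj P hP.mem a hP.ne
  -- `g` kills `ker a`
  have hker : LinearMap.ker a ≤ LinearMap.ker g := by
    intro z hz
    obtain ⟨h, hh⟩ := hN.gen _ hak ⟨z, hz⟩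
    have h1 := hdec (ModuleCat.of A (LinearMap.ker a)) Y (g ∘ₗ (LinearMap.ker a).subtype)
      (fun v => hVY _) (fun r => by
        by_contra hr
        obtain ⟨t, ht⟩ := horb ((LinearMap.ker a).subtype ∘ₗ r) hr
        have hb := hP.bij (LinearMap.id - (LinearMap.ker a).subtype ∘ₗ r ∘ₗ t) (by
          ext x
          show a (x - (r (t x)).1) = a x
          have : a (r (t x)).1 = 0 := (r (t x)).2
          rw [map_sub, this, sub_zero])
        apply hg
        ext x
        obtain ⟨x', rfl⟩ := hb.2 x
        show g (x' - (r (t x')).1) = 0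
        rw [map_sub, sub_eq_zero]
        exact (LinearMap.congr_fun ht x').symm) h
    have h2 : g (h n0).1 = 0 := LinearMap.congr_fun h1 n0
    rw [hh] at h2
    exact h2
  let ea := a.quotKerEquivOfSurjective has
  let gb : B →ₗ[A] Y := (LinearMap.ker a).liftQ g hker ∘ₗ ea.symm.toLinearMap
  have hgb : ∀ x, gb (a x) = g x := by
    intro x
    have h4 : ea.symm (a x) = (LinearMap.ker a).mkQ x := by
      rw [LinearEquiv.symm_apply_eq]; rfl
    show (LinearMap.ker a).liftQ g hker (ea.symm (a x)) = g x
    rw [h4]; rfl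
  have hgb0 : gb ≠ 0 := by
    intro h0
    apply hg
    ext x
    rw [← hgb, h0]; rfl
  have hinj : Function.Injective gb := by
    rw [← LinearMap.ker_eq_bot, eq_bot_iff]
    intro c hc
    obtain ⟨φ, hφ⟩ := hN.gen B hB.mem c
    obtain ⟨l, hl⟩ := exists_factor (n0 := n0) (gb ∘ₗ φ) (by
      rw [LinearMap.comp_apply, hφ]; exact hc)
    rw [hLY l, LinearMap.zero_comp] at hl
    by_cases hφ0 : φ = 0
    · rw [← hφ, hφ0]; simp
    · exfalso
      have := hB.surj N hN.mem φ hφ0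
      apply hgb0
      ext x
      obtain ⟨x', rfl⟩ := this x
      exact (LinearMap.congr_fun hl x').symm
  let R := LinearMap.range gb
  have hRT : T (ModuleCat.of A R) := hT.range hB.mem gb
  have hkT : T (ModuleCat.of A (LinearMap.ker R.mkQ)) := by
    rw [Submodule.ker_mkQ]; exact hRT
  have hRne : R ≠ ⊥ := by
    intro h
    exact hgb0 (LinearMap.range_eq_bot.1 h)
  have hzero := ih _ (by rw [← hn]; exact len_quot_lt Y hfY R hRne) (ModuleCat.of A (Y ⧸ R)) rfl
    (hU.tors.quotient hY R) (fun v => by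
      obtain ⟨h, hh⟩ := hV Y (ModuleCat.of A (Y ⧸ R)) hTY R.mkQ R.mkQ_surjective hkT v
      rw [← hh, hVY h, LinearMap.comp_zero]) (fun l => by
      obtain ⟨h, hh⟩ := hN.epL hT Y (ModuleCat.of A (Y ⧸ R)) hTY R.mkQ R.mkQ_surjective hkT l
      rw [← hh, hLY h, LinearMap.comp_zero])
  have hsurj : Function.Surjective gb := by
    intro z
    have : R.mkQ z = 0 := hzero _
    have h1 : z ∈ R := by simpa using this
    exact h1
  let e := LinearEquiv.ofBijective gb ⟨hinj, hsurj⟩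
  have hUB : U B := hU.tors.surj hY e.symm.toLinearMap e.symm.surjective
  obtain ⟨b, hb⟩ := hB.nz
  exact hb (zero_of_perp hUB hB.perp b)

theorem isFac_max (K : Type) [Field K] [Algebra K A] [FiniteDimensional K A]
    (hT : IsTorsionClass A T) (hfac : IsFac T) (hU : IsMaxBelow T U) : IsFac U := by
  obtain ⟨B, hB⟩ := hU.exists_label hT
  obtain ⟨N, n0, hN⟩ := exists_appr K hT hfac
  obtain ⟨P, a, hP⟩ := exists_prj hT hN hB
  obtain ⟨V, hV1, hV2, hV3, hV4⟩ := decomp hT hB hP _ N rfl hN.mem (hN.epN hT)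
  have hcl := claim K hT hU hN hB hP hV2 hV4
  have hUV : U V := (hB.iff V hV1).2 hV3
  have hLT := hT.quotient hN.mem (Submodule.span A {n0})
  have hUL := (hB.iff _ hLT).2 (homLB hT hN hB hP)
  let L := N ⧸ Submodule.span A {n0}
  have hUW := hU.tors.prod hUV hUL
  refine ⟨ModuleCat.of A (V × L), hUW, fun X hX => ?_⟩
  have hTX := hU.le X hX
  have hfX := hT.fin X hTX
  obtain ⟨R, ⟨n, f, hf⟩, hmax⟩ := WellFounded.has_min (wellFounded_gt (α := Submodule A X))
    {R | ∃ (n : ℕ) (f : (Fin n → (V × L)) →ₗ[A] X), LinearMap.range f = R} ⟨_, 0, 0, rfl⟩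
  have hclosed : ∀ h : (V × L) →ₗ[A] X, LinearMap.range h ≤ R := by
    intro h
    by_contra hnle
    refine hmax (LinearMap.range h ⊔ R) ⟨n + 1, (h.coprod f) ∘ₗ
      (Fin.consLinearEquiv A (fun _ => V × L)).symm.toLinearMap, ?_⟩ ?_
    · rw [LinearMap.range_comp_of_range_eq_top _ (LinearEquiv.range _), LinearMap.range_coprod, hf]
    · refine lt_of_le_of_ne le_sup_right (fun h => hnle ?_)
      rw [h]; exact le_sup_left
  have hRT : T (ModuleCat.of A R) := by
    rw [← hf]
    exact hT.range (X := ModuleCat.of A (Fin n → (V × L))) (hT.pi (X := ModuleCat.of A (V × L))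
      (hU.le _ hUW) n) f
  have hkT : T (ModuleCat.of A (LinearMap.ker R.mkQ)) := by
    rw [Submodule.ker_mkQ]; exact hRT
  have hzero := hcl _ (ModuleCat.of A (X ⧸ R)) rfl (hU.tors.quotient hX R) (fun v => by
      obtain ⟨h, hh⟩ := hV2 X (ModuleCat.of A (X ⧸ R)) hTX R.mkQ R.mkQ_surjective hkT v
      rw [← hh]
      ext x
      have h1 := hclosed (h ∘ₗ LinearMap.fst A V L) ⟨(x, 0), rfl⟩
      show R.mkQ (h x) = 0
      simpa using h1) (fun l => by
      obtain ⟨h, hh⟩ := hN.epL hT X (ModuleCat.of A (X ⧸ R)) hTX R.mkQ R.mkQ_surjective hkT l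
      rw [← hh]
      apply LinearMap.ext
      intro x
      have h1 := hclosed (h ∘ₗ LinearMap.snd A V L) ⟨(0, x), rfl⟩
      show R.mkQ (h x) = 0
      simpa using h1)
  refine ⟨n, f, ?_⟩
  rw [← LinearMap.range_eq_top, hf, eq_top_iff]
  intro x _
  have : R.mkQ x = 0 := hzero _
  simpa using this

end TL

section Lattice

/-- The poset of torsion classes. -/
abbrev Tors (A : Type) [Ring A] := {T : ModuleCat.{0} A → Prop // IsTorsionClass A T}

variable {A : Type} [Ring A]

/-- All finitely generated modules. -/
def topTors [IsArtinianRing A] : Tors A :=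
  ⟨fun X => Module.Finite A X, isTorsionClass_all inferInstance⟩

theorem le_topTors [IsArtinianRing A] (T : Tors A) : T ≤ topTors := fun X hX => T.2.fin X hX

theorem isFac_top [IsArtinianRing A] : IsFac (topTors (A := A)).1 := by
  refine ⟨ModuleCat.of A A, inferInstanceAs (Module.Finite A A), fun X hX => ?_⟩
  have : Module.Finite A X := hX
  exact Module.Finite.exists_fin' A X

variable [IsArtinianRing A]

theorem finite_Iic_of_dcc (K : Type) [Field K] [Algebra K A] [FiniteDimensional K A]
    (hwf : WellFoundedLT (Tors A)) (T : Tors A) (hT : IsFac T.1) :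
    (Set.Iic T).Finite := by
  induction T using hwf.wf.induction with
  | _ T ih =>
  have h1 := finite_max T.2 hT
  have h2 : (⋃ U ∈ {U | IsMaxBelow T.1 U}, {V : Tors A | V.1 ≤ U}).Finite := by
    refine h1.biUnion fun U hU => ?_
    have hUm : IsMaxBelow T.1 U := hU
    refine ih ⟨U, hUm.tors⟩ ?_ (isFac_max K T.2 hT hUm)
    exact lt_of_le_of_ne hUm.le (fun h => hUm.ne (congrArg Subtype.val h))
  refine (h2.insert T).subset fun V hV => ?_
  by_cases hVT : V = T
  · left; exact hVT
  · right
    obtain ⟨U, hU, hVU⟩ := exists_max T.2 hT V.2 hV (fun h => hVT (Subtype.ext h))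
    simp only [Set.mem_iUnion]
    exact ⟨U, hU, hVU⟩

theorem finite_of_dcc (K : Type) [Field K] [Algebra K A] [FiniteDimensional K A]
    (hwf : WellFoundedLT (Tors A)) : Finite (Tors A) := by
  have h := finite_Iic_of_dcc K hwf topTors isFac_top
  rw [← Set.finite_univ_iff]
  exact h.subset fun T _ => le_topTors T

theorem all_isFac_of_finite (K : Type) [Field K] [Algebra K A] [FiniteDimensional K A]
    (hfin : Finite (Tors A)) (T : Tors A) : IsFac T.1 := by
  obtain ⟨S, hS⟩ := Set.Finite.exists_minimal (Set.toFinite {S : Tors A | T ≤ S ∧ IsFac S.1})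
    ⟨topTors, le_topTors T, isFac_top⟩
  by_cases hTS : T = S
  · rw [hTS]; exact hS.prop.2
  · exfalso
    obtain ⟨U, hU, hTU⟩ := exists_max S.2 hS.prop.2 T.2 hS.prop.1 (fun h => hTS (Subtype.ext h))
    have h1 := hS.le_of_le (y := (⟨U, hU.tors⟩ : Tors A)) ⟨hTU, isFac_max K S.2 hS.prop.2 hU⟩ hU.le
    exact hU.ne (le_antisymm hU.le h1)

theorem acc_of_compact (h : ∀ T : Tors A, ∃ M, T.1 M ∧ ∀ T' : Tors A, T'.1 M → T ≤ T') :
    WellFoundedGT (Tors A) := by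
  rw [wellFoundedGT_iff_monotone_chain_condition]
  intro a
  have hc : IsChain (· ≤ ·) (Set.range fun n => (a n).1) := by
    rintro _ ⟨i, rfl⟩ _ ⟨j, rfl⟩ _
    rcases le_total i j with hij | hij
    · left; exact a.monotone hij
    · right; exact a.monotone hij
  obtain ⟨M, hM, hmin⟩ := h ⟨_, isTorsion_sUnion hc ⟨_, 0, rfl⟩ (by rintro _ ⟨n, rfl⟩; exact (a n).2)⟩
  obtain ⟨_, ⟨n, rfl⟩, hn⟩ := hM
  refine ⟨n, fun m hm => le_antisymm (a.monotone hm) ?_⟩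
  refine le_trans ?_ (hmin (a n) hn)
  intro X hX
  exact ⟨_, ⟨m, rfl⟩, hX⟩

theorem acc_of_isFac (h : ∀ T : Tors A, IsFac T.1) : WellFoundedGT (Tors A) := by
  apply acc_of_compact
  intro T
  obtain ⟨M, hM, hgen⟩ := h T
  exact ⟨M, hM, fun T' hT' => IsFac.le_of_mem hgen T'.2 hT'⟩

end Lattice

section Duality
open MulOpposite
variable {K A B : Type} [Field K] [Ring A] [Ring B] [Algebra K A] [Algebra K B]

/-- Restriction of scalars (a type synonym). -/
def RS (K A : Type) [Field K] [Ring A] [Algebra K A] (X : Type) [AddCommGroup X] [Module A X] :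
    Type := X

instance (X : Type) [AddCommGroup X] [Module A X] : AddCommGroup (RS K A X) :=
  inferInstanceAs (AddCommGroup X)

instance (X : Type) [AddCommGroup X] [Module A X] : Module A (RS K A X) :=
  inferInstanceAs (Module A X)

instance (X : Type) [AddCommGroup X] [Module A X] : Module K (RS K A X) :=
  Module.compHom X (algebraMap K A)

instance (X : Type) [AddCommGroup X] [Module A X] : IsScalarTower K A (RS K A X) :=
  IsScalarTower.of_algebraMap_smul fun _ _ => rfl

/-- The dual as a module over `B`, where `σ : B → Aᵒᵖ`. -/
@[reducible] def dualModule (σ : B →+* Aᵐᵒᵖ) (X : Type) [AddCommGroup X] [Module A X] :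
    Module B (Module.Dual K (RS K A X)) where
  smul b l := l ∘ₗ Algebra.lsmul K K (RS K A X) (unop (σ b))
  one_smul l := by
    ext x
    show l (unop (σ 1) • x) = l x
    rw [map_one, unop_one, one_smul]
  mul_smul b c l := by
    ext x
    show l (unop (σ (b * c)) • x) = l (unop (σ c) • unop (σ b) • x)
    rw [map_mul, unop_mul, mul_smul]
  smul_zero b := by
    ext x; rfl
  smul_add b l l' := by
    ext x; rfl
  add_smul b c l := by
    ext x
    show l (unop (σ (b + c)) • x) = l (unop (σ b) • x) + l (unop (σ c) • x)
    rw [map_add, unop_add, add_smul, map_add]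
  zero_smul l := by
    ext x
    show l (unop (σ 0) • x) = 0
    rw [map_zero, unop_zero, zero_smul, map_zero]

/-- The dual of an `A`-module as a `B`-module. -/
def DD (K : Type) {A B : Type} [Field K] [Ring A] [Ring B] [Algebra K A] [Algebra K B]
    (σ : B →+* Aᵐᵒᵖ) (X : ModuleCat.{0} A) : ModuleCat.{0} B :=
  @ModuleCat.of B _ (Module.Dual K (RS K A X)) _ (dualModule σ X)

/-- evaluation -/
def DD.app {σ : B →+* Aᵐᵒᵖ} {X : ModuleCat.{0} A} (l : DD K σ X) :
    Module.Dual K (RS K A X) := l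

theorem DD.app_smul {σ : B →+* Aᵐᵒᵖ} {X : ModuleCat.{0} A} (b : B) (l : DD K σ X) (x : X) :
    DD.app (b • l) x = DD.app l (unop (σ b) • x : X) := rfl

theorem DD.app_add {σ : B →+* Aᵐᵒᵖ} {X : ModuleCat.{0} A} (l l' : DD K σ X) (x : X) :
    DD.app (l + l') x = DD.app l x + DD.app l' x := rfl

theorem DD.app_scalar {σ : B →+* Aᵐᵒᵖ} {X : ModuleCat.{0} A} (l : DD K σ X) (c : K) (x : X) :
    DD.app l (algebraMap K A c • x : X) = c * DD.app l x :=
  LinearMap.map_smul (M := RS K A X) (DD.app l) c x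

theorem DD.app_map_add {σ : B →+* Aᵐᵒᵖ} {X : ModuleCat.{0} A} (l : DD K σ X) (x y : X) :
    DD.app l (x + y : X) = DD.app l x + DD.app l y :=
  LinearMap.map_add (M := RS K A X) (DD.app l) x y

/-- Build an element of the dual. -/
def DD.mk {σ : B →+* Aᵐᵒᵖ} {X : ModuleCat.{0} A} (f : X → K)
    (h1 : ∀ x y, f (x + y) = f x + f y) (h2 : ∀ c x, f (algebraMap K A c • x) = c * f x) :
    DD K σ X :=
  ({ toFun := f, map_add' := h1, map_smul' := h2 } : Module.Dual K (RS K A X))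

theorem DD.app_mk {σ : B →+* Aᵐᵒᵖ} {X : ModuleCat.{0} A} (f : X → K)
    (h1 : ∀ x y, f (x + y) = f x + f y) (h2 : ∀ c x, f (algebraMap K A c • x) = c * f x) (x : X) :
    DD.app (DD.mk (σ := σ) f h1 h2) x = f x := rfl

theorem DD.ext {σ : B →+* Aᵐᵒᵖ} {X : ModuleCat.{0} A} {l k : DD K σ X}
    (h : ∀ x : X, DD.app l x = DD.app k x) : l = k :=
  LinearMap.ext (f := DD.app l) (g := DD.app k) h

/-- Compatible pair of anti-homomorphisms. -/
structure AntiPair (K : Type) {A B : Type} [Field K] [Ring A] [Ring B] [Algebra K A]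
    [Algebra K B] (σ : B →+* Aᵐᵒᵖ) (τ : A →+* Bᵐᵒᵖ) : Prop where
  hσ : ∀ c : K, unop (σ (algebraMap K B c)) = algebraMap K A c
  hτ : ∀ c : K, unop (τ (algebraMap K A c)) = algebraMap K B c
  h1 : ∀ b, unop (τ (unop (σ b))) = b
  h2 : ∀ a, unop (σ (unop (τ a))) = a

variable {σ : B →+* Aᵐᵒᵖ} {τ : A →+* Bᵐᵒᵖ}

theorem AntiPair.symm (h : AntiPair K σ τ) : AntiPair K τ σ := ⟨h.hτ, h.hσ, h.h2, h.h1⟩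

/-- Transpose of a map into a dual. -/
def AntiPair.tr (h : AntiPair K σ τ) {X : ModuleCat.{0} A} {Y : ModuleCat.{0} B}
    (g : Y →ₗ[B] DD K σ X) : X →ₗ[A] DD K τ Y where
  toFun x := DD.mk (fun y => DD.app (g y) x)
    (fun y y' => by rw [map_add]; rfl)
    (fun c y => by rw [map_smul, DD.app_smul, h.hσ, DD.app_scalar])
  map_add' x x' := DD.ext fun y => by
    rw [DD.app_add, DD.app_mk, DD.app_mk, DD.app_mk, DD.app_map_add]
  map_smul' a x := DD.ext fun y => by
    rw [RingHom.id_apply, DD.app_smul, DD.app_mk, DD.app_mk, map_smul, DD.app_smul, h.h2]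

theorem AntiPair.tr_app (h : AntiPair K σ τ) {X : ModuleCat.{0} A} {Y : ModuleCat.{0} B}
    (g : Y →ₗ[B] DD K σ X) (x : X) (y : Y) : DD.app (h.tr g x) y = DD.app (g y) x := rfl

theorem AntiPair.zero_of (h : AntiPair K σ τ) {X : ModuleCat.{0} A} {Y : ModuleCat.{0} B}
    (h0 : ∀ f : X →ₗ[A] DD K τ Y, f = 0) (g : Y →ₗ[B] DD K σ X) : g = 0 := by
  have h1 := h0 (h.tr g)
  apply LinearMap.ext
  intro y
  apply DD.ext
  intro x
  rw [← h.tr_app g x y, h1]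
  rfl

/-- view a functional as an element of the dual module -/
def DD.of {X : ModuleCat.{0} A} (l : Module.Dual K (RS K A X)) : DD K σ X := l

theorem AntiPair.app_csmul (h : AntiPair K σ τ) {X : ModuleCat.{0} A} (c : K)
    (l : Module.Dual K (RS K A X)) :
    c • l = DD.app (algebraMap K B c • DD.of (σ := σ) (X := X) l) := by
  apply LinearMap.ext
  intro x
  refine Eq.trans ?_ (DD.app_smul (algebraMap K B c) (DD.of (σ := σ) (X := X) l) x).symm
  rw [h.hσ]
  exact (DD.app_scalar (DD.of (σ := σ) (X := X) l) c x).symm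

variable [FiniteDimensional K A]

theorem finite_RS (X : ModuleCat.{0} A) (hX : Module.Finite A X) :
    Module.Finite K (RS K A X) := by
  haveI : Module.Finite A (RS K A X) := hX
  exact Module.Finite.trans A _

theorem AntiPair.dd_finite (h : AntiPair K σ τ) (X : ModuleCat.{0} A) (hX : Module.Finite A X) :
    Module.Finite B (DD K σ X) := by
  haveI := finite_RS (K := K) X hX
  letI : Module B (Module.Dual K (RS K A X)) := dualModule σ X
  haveI : IsScalarTower K B (Module.Dual K (RS K A X)) := by
    apply IsScalarTower.of_algebraMap_smul
    intro c l
    apply LinearMap.ext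
    intro x
    show l (unop (σ (algebraMap K B c)) • x) = c * l x
    rw [h.hσ]
    exact LinearMap.map_smul l c x
  exact Module.Finite.of_restrictScalars_finite K B (Module.Dual K (RS K A X))

theorem AntiPair.double (h : AntiPair K σ τ) (X : ModuleCat.{0} A) (hX : Module.Finite A X) :
    Nonempty (X ≃ₗ[A] DD K τ (DD K σ X)) := by
  haveI := finite_RS (K := K) X hX
  refine ⟨LinearEquiv.ofBijective (h.tr (X := X) (Y := DD K σ X) LinearMap.id) ⟨?_, ?_⟩⟩
  · rw [← LinearMap.ker_eq_bot, eq_bot_iff]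
    intro x hx
    have hx' : h.tr (X := X) (Y := DD K σ X) LinearMap.id x = 0 := hx
    refine (Module.forall_dual_apply_eq_zero_iff K (V := RS K A X) x).1 fun l => ?_
    have h1 := h.tr_app (X := X) (Y := DD K σ X) LinearMap.id x l
    rw [hx'] at h1
    exact h1.symm
  · intro ψ
    let ψ' : Module.Dual K (Module.Dual K (RS K A X)) :=
      { toFun := fun l => DD.app ψ (l : DD K σ X)
        map_add' := fun l l' => DD.app_map_add ψ (l : DD K σ X) (l' : DD K σ X)
        map_smul' := fun c l => by
          have h3 : (c • l : Module.Dual K (RS K A X)) =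
              DD.app (algebraMap K B c • DD.of (σ := σ) (X := X) l) := h.app_csmul c l
          rw [h3]
          exact DD.app_scalar ψ c (l : DD K σ X) }
    obtain ⟨x, hx⟩ := (Module.evalEquiv K (RS K A X)).surjective ψ'
    refine ⟨x, DD.ext fun l => ?_⟩
    have := LinearMap.congr_fun hx l
    exact this

variable [FiniteDimensional K B]

/-- The antitone map on torsion classes. -/
def AntiPair.phi (_ : AntiPair K σ τ) (T : Tors A) : Tors B :=
  ⟨leftPerp (fun Z => ∃ X, T.1 X ∧ Z = DD K σ X), isTorsion_leftPerp _⟩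

theorem AntiPair.gc_one (h : AntiPair K σ τ) {T : Tors A} {S : Tors B}
    (hle : T ≤ h.symm.phi S) : S ≤ h.phi T := by
  intro Y hY
  refine ⟨S.2.fin Y hY, ?_⟩
  rintro _ ⟨X, hX, rfl⟩ f
  exact h.zero_of (fun f => (hle X hX).2 _ ⟨Y, hY, rfl⟩ f) f

theorem AntiPair.phi_phi_le [IsArtinianRing A] (h : AntiPair K σ τ) (T : Tors A) :
    h.symm.phi (h.phi T) ≤ T := by
  intro X hX
  refine T.2.mem_of_perp X hX.1 fun Z hZ f => ?_
  obtain ⟨e⟩ := h.double Z hZ.1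
  have h1 : (h.phi T).1 (DD K σ Z) := by
    refine ⟨h.dd_finite Z hZ.1, ?_⟩
    rintro _ ⟨X', hX', rfl⟩ g
    refine h.zero_of (fun f => ?_) g
    have := hZ.2 X' hX' (e.symm.toLinearMap ∘ₗ f)
    ext x
    have h3 : e.symm (f x) = 0 := LinearMap.congr_fun this x
    simpa using h3
  have h2 := hX.2 _ ⟨_, h1, rfl⟩ (e.toLinearMap ∘ₗ f)
  ext x
  have h3 : e (f x) = 0 := LinearMap.congr_fun h2 x
  simpa using h3

theorem AntiPair.phi_phi [IsArtinianRing A] (h : AntiPair K σ τ) (T : Tors A) :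
    h.symm.phi (h.phi T) = T :=
  le_antisymm (h.phi_phi_le T) (h.symm.gc_one (T := h.phi T) (S := T) le_rfl)

theorem AntiPair.phi_anti (h : AntiPair K σ τ) {T T' : Tors A} (hle : T ≤ T') :
    h.phi T' ≤ h.phi T := by
  intro Y hY
  refine ⟨hY.1, ?_⟩
  rintro _ ⟨X, hX, rfl⟩ f
  exact hY.2 _ ⟨X, hle X hX, rfl⟩ f

/-- The anti-isomorphism. -/
def AntiPair.iso [IsArtinianRing A] [IsArtinianRing B] (h : AntiPair K σ τ) :
    Tors A ≃o (Tors B)ᵒᵈ where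
  toFun T := OrderDual.toDual (h.phi T)
  invFun S := h.symm.phi (OrderDual.ofDual S)
  left_inv T := h.phi_phi T
  right_inv S := h.symm.phi_phi (OrderDual.ofDual S)
  map_rel_iff' := by
    intro T T'
    constructor
    · intro hle
      have h1 : h.phi T' ≤ h.phi T := hle
      have h2 := h.symm.phi_anti h1
      rwa [h.phi_phi, h.phi_phi] at h2
    · intro hle
      exact h.phi_anti hle

theorem exists_iso (K A : Type) [Field K] [Ring A] [Algebra K A] [FiniteDimensional K A]
    [IsArtinianRing A] [IsArtinianRing Aᵐᵒᵖ] : Nonempty (Tors A ≃o (Tors Aᵐᵒᵖ)ᵒᵈ) := by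
  haveI : FiniteDimensional K Aᵐᵒᵖ := inferInstance
  have h : AntiPair K (RingHom.id Aᵐᵒᵖ) ((RingEquiv.opOp A).toRingHom) :=
    ⟨fun c => rfl, fun c => rfl, fun b => rfl, fun a => rfl⟩
  exact ⟨h.iso⟩

end Duality

section Implications
variable {A : Type} [Ring A] [IsArtinianRing A]

theorem nonzero_absurd {T : ModuleCat.{0} A → Prop} {B : ModuleCat.{0} A} (h1 : T B)
    (h2 : rightPerp A T B) (h3 : Nonzero A B) : False := by
  obtain ⟨b, hb⟩ := h3
  exact hb (zero_of_perp h1 h2 b)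

theorem imp_a_b (h : ∃ (m : ℕ) (f : Fin m → ModuleCat.{0} A),
    ∀ M : ModuleCat.{0} A, IsBrick A M → ∃ i, Nonempty (M ≃ₗ[A] f i)) : Finite (Tors A) := by
  obtain ⟨m, f, hf⟩ := h
  have key : ∀ T1 T2 : Tors A, (∀ i, T1.1 (f i) → T2.1 (f i)) → T1 ≤ T2 := by
    intro T1 T2 h12
    by_contra hle
    have hex : ∃ X, T1.1 X ∧ ¬ T2.1 X := by
      by_contra hno
      push Not at hno
      exact hle hno
    obtain ⟨B, h1, h2, h3, h4⟩ := exists_min_brick T1.2 T2.2 hex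
    obtain ⟨i, ⟨e⟩⟩ := hf B (brick_of_surj (T1.2.fin B h1) h3 (h4 B h1))
    have h5 := h12 i (T1.2.surj h1 e.toLinearMap e.surjective)
    exact nonzero_absurd (T2.2.surj h5 e.symm.toLinearMap e.symm.surjective) h2 h3
  apply Finite.of_injective (fun T : Tors A => {i | T.1 (f i)})
  intro T1 T2 h
  have h' : ∀ i, T1.1 (f i) ↔ T2.1 (f i) := fun i => Set.ext_iff.1 h i
  exact le_antisymm (key T1 T2 fun i => (h' i).1) (key T2 T1 fun i => (h' i).2)

/-- The torsion class generated by one module. -/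
def gen (M : ModuleCat.{0} A) (hM : Module.Finite A M) : Tors A :=
  ⟨torsClosure A (fun X => X = M), torsClosure_isTorsion _ (by rintro X rfl; exact hM)⟩

theorem mem_gen (M : ModuleCat.{0} A) (hM : Module.Finite A M) : (gen M hM).1 M :=
  fun _ _ h => h M rfl

theorem gen_le (M : ModuleCat.{0} A) (hM : Module.Finite A M) (T : Tors A) (h : T.1 M) :
    gen M hM ≤ T := fun X hX => hX T.1 T.2 (by rintro _ rfl; exact h)

theorem brick_surj {B B' : ModuleCat.{0} A} (hB : IsBrick A B) (hB' : IsBrick A B')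
    (h : gen B hB.1 = gen B' hB'.1) : ∃ f : B →ₗ[A] B', Function.Surjective f := by
  have h1 : ∃ f : B →ₗ[A] B', f ≠ 0 := by
    by_contra hno
    push Not at hno
    have h2 := gen_le B hB.1 ⟨_, (topTors (A := A)).2.perp B'⟩ ⟨hB.1, hno⟩
    rw [h] at h2
    have h3 := (h2 B' (mem_gen B' hB'.1)).2 LinearMap.id
    obtain ⟨b, hb⟩ := hB'.2.1
    exact hb (LinearMap.congr_fun h3 b)
  obtain ⟨f, hf⟩ := h1
  have h2 := gen_le B' hB'.1 ⟨_, (topTors (A := A)).2.zeroOrSurj B'⟩ ⟨hB'.1, fun f => by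
    by_cases hf : f = 0
    · left; exact hf
    · right; exact (hB'.2.2 f hf).2⟩
  rw [← h] at h2
  exact ⟨f, ((h2 B (mem_gen B hB.1)).2 f).resolve_left hf⟩

theorem brick_iso {B B' : ModuleCat.{0} A} (hB : IsBrick A B) (hB' : IsBrick A B')
    (h : gen B hB.1 = gen B' hB'.1) : Nonempty (B ≃ₗ[A] B') := by
  obtain ⟨f, hf⟩ := brick_surj hB hB' h
  obtain ⟨g, hg⟩ := brick_surj hB' hB h.symm
  exact ⟨LinearEquiv.ofBijective f (bij_of_surj_len hB.1 f hf (len_le_of_surj hB'.1 g hg))⟩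

theorem imp_b_a (h : Finite (Tors A)) : ∃ (m : ℕ) (f : Fin m → ModuleCat.{0} A),
    ∀ M : ModuleCat.{0} A, IsBrick A M → ∃ i, Nonempty (M ≃ₗ[A] f i) := by
  classical
  obtain ⟨m, ⟨e⟩⟩ := Finite.exists_equiv_fin (Tors A)
  let pick : Tors A → ModuleCat.{0} A := fun T =>
    if h : ∃ (B : ModuleCat.{0} A) (hB : IsBrick A B), gen B hB.1 = T then h.choose
    else ModuleCat.of A A
  refine ⟨m, fun i => pick (e.symm i), fun M hM => ⟨e (gen M hM.1), ?_⟩⟩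
  have hex : ∃ (B : ModuleCat.{0} A) (hB : IsBrick A B), gen B hB.1 = gen M hM.1 := ⟨M, hM, rfl⟩
  have h1 : pick (e.symm (e (gen M hM.1))) = hex.choose := by
    rw [Equiv.symm_apply_apply]
    exact dif_pos hex
  show Nonempty (M ≃ₗ[A] (pick (e.symm (e (gen M hM.1))) : ModuleCat.{0} A))
  rw [h1]
  obtain ⟨h2, h3⟩ := hex.choose_spec
  exact brick_iso hM h2 h3.symm

theorem imp_c_e {T : ModuleCat.{0} A → Prop} (hT : IsTorsionClass A T)
    (h : FunctoriallyFinite A T) : IsCompactTors A T := by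
  obtain ⟨X, f, hX, hf⟩ := h.1 (ModuleCat.of A A) (inferInstanceAs (Module.Finite A A))
  refine ⟨X, hT.fin X hX, le_antisymm ?_ (fun Y hY => hY T hT (by rintro _ rfl; exact hX))⟩
  intro Y hY T' hT' hXT'
  have hfY := hT.fin Y hY
  obtain ⟨n, g, hg⟩ := Module.Finite.exists_fin' A Y
  choose k hk using fun i => hf Y hY (g ∘ₗ LinearMap.single A (fun _ : Fin n => A) i)
  let F : (Fin n → X) →ₗ[A] Y := ∑ i, k i ∘ₗ LinearMap.proj i
  have hF : F ∘ₗ LinearMap.pi (fun i => f ∘ₗ LinearMap.proj i) = g := by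
    apply LinearMap.pi_ext'
    intro i
    rw [← hk i]
    apply LinearMap.ext
    intro x
    show (∑ j, k j ∘ₗ LinearMap.proj j) (fun j => f (Pi.single (M := fun _ => A) i x j)) = k i (f x)
    rw [LinearMap.sum_apply, Finset.sum_eq_single i]
    · simp
    · intro j _ hj
      simp [Pi.single_eq_of_ne hj]
    · simp
  have hFs : Function.Surjective F := by
    intro y
    obtain ⟨x, rfl⟩ := hg y
    exact ⟨_, LinearMap.congr_fun hF x⟩
  exact hT'.surj (hT'.pi (hXT' X rfl) n) F hFs

theorem isFac_compact {T : ModuleCat.{0} A → Prop} (hT : IsTorsionClass A T)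
    (h : IsFac T) : IsCompactTors A T := by
  obtain ⟨M, hM, hgen⟩ := h
  refine ⟨M, hT.fin M hM, le_antisymm ?_ (fun Y hY => hY T hT (by rintro _ rfl; exact hM))⟩
  exact IsFac.le_of_mem hgen (gen M (hT.fin M hM)).2 (mem_gen M (hT.fin M hM))

theorem isFac_functFinite (K : Type) [Field K] [Algebra K A] [FiniteDimensional K A]
    {T : ModuleCat.{0} A → Prop} (hT : IsTorsionClass A T)
    (h : IsFac T) : FunctoriallyFinite A T := by
  constructor
  · intro M hM
    obtain ⟨N, n0, hN⟩ := exists_appr K hT h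
    obtain ⟨n, g, hg⟩ := Module.Finite.exists_fin' A M
    let ι : (Fin n → A) →ₗ[A] (Fin n → N) :=
      LinearMap.pi (fun i => LinearMap.toSpanSingleton A N n0 ∘ₗ LinearMap.proj i)
    let R := (LinearMap.ker g).map ι
    have hR : LinearMap.ker g ≤ LinearMap.ker (R.mkQ ∘ₗ ι) := by
      intro x hx
      have : ι x ∈ R := ⟨x, hx, rfl⟩
      simpa using this
    let eg := g.quotKerEquivOfSurjective hg
    let f : M →ₗ[A] ((Fin n → N) ⧸ R) :=
      (LinearMap.ker g).liftQ (R.mkQ ∘ₗ ι) hR ∘ₗ eg.symm.toLinearMap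
    have hfg : ∀ x, f (g x) = R.mkQ (ι x) := by
      intro x
      have h4 : eg.symm (g x) = (LinearMap.ker g).mkQ x := by
        rw [LinearEquiv.symm_apply_eq]; rfl
      show (LinearMap.ker g).liftQ (R.mkQ ∘ₗ ι) hR (eg.symm (g x)) = _
      rw [h4]; rfl
    refine ⟨ModuleCat.of A ((Fin n → N) ⧸ R), f,
      hT.quotient (X := ModuleCat.of A (Fin n → N)) (hT.pi hN.mem n) R, fun Y hY k => ?_⟩
    choose l hl using fun i => hN.gen Y hY (k (g (Pi.single i 1)))
    let H : (Fin n → N) →ₗ[A] Y := ∑ i, l i ∘ₗ LinearMap.proj i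
    have hH : ∀ x, H (ι x) = k (g x) := by
      suffices h : H ∘ₗ ι = k ∘ₗ g from fun x => LinearMap.congr_fun h x
      apply LinearMap.pi_ext'
      intro i
      apply LinearMap.ext_ring
      show (∑ j, l j ∘ₗ LinearMap.proj j)
        (fun j => (Pi.single (M := fun _ => A) i (1 : A) j) • n0) = k (g (Pi.single i 1))
      rw [LinearMap.sum_apply, Finset.sum_eq_single i]
      · simp [hl]
      · intro j _ hj
        simp [Pi.single_eq_of_ne hj]
      · simp
    have hRH : R ≤ LinearMap.ker H := by
      rintro _ ⟨x, hx, rfl⟩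
      have hx' : g x = 0 := hx
      rw [LinearMap.mem_ker, hH, hx', map_zero]
    refine ⟨R.liftQ H hRH, ?_⟩
    apply LinearMap.ext
    intro m
    obtain ⟨x, rfl⟩ := hg m
    show R.liftQ H hRH (f (g x)) = k (g x)
    rw [hfg, ← hH]; rfl
  · intro M hM
    obtain ⟨N, h1, h2⟩ := hT.exists_tors M hM
    refine ⟨ModuleCat.of A N, N.subtype, h1, fun Y hY g => ?_⟩
    have h3 := h2.2 Y hY (N.mkQ ∘ₗ g)
    exact ⟨g.codRestrict N (fun y => by
      have : N.mkQ (g y) = 0 := LinearMap.congr_fun h3 y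
      simpa using this), rfl⟩

theorem imp_b_cocompact (hfin : Finite (Tors A)) {T : ModuleCat.{0} A → Prop} :
    IsCocompactTors A T := by
  let lp : ModuleCat.{0} A → Tors A := fun N => ⟨leftPerp (fun X => X = N), isTorsion_leftPerp _⟩
  have hz : rightPerp A T (ModuleCat.of A PUnit) :=
    isTorsionFree_rightPerp.zero _ (fun x => Subsingleton.elim _ _)
  obtain ⟨N, hN, hmin⟩ := WellFounded.has_min
    (InvImage.wf lp (wellFounded_lt (α := Tors A))) {N | rightPerp A T N} ⟨_, hz⟩
  have hN' : rightPerp A T N := hN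
  refine ⟨N, hN'.1, le_antisymm ?_ (fun Y hY => hY _ isTorsionFree_rightPerp
    (by rintro _ rfl; exact hN'))⟩
  intro Y hY
  have hfN := hN'.1
  have hfY := hY.1
  have hprod : rightPerp A T (ModuleCat.of A (N × Y)) := by
    refine ⟨inferInstanceAs (Module.Finite A (N × Y)), fun M hM f => ?_⟩
    have h1 := hN'.2 M hM (LinearMap.fst A N Y ∘ₗ f)
    have h2 := hY.2 M hM (LinearMap.snd A N Y ∘ₗ f)
    apply LinearMap.ext
    intro x
    exact Prod.ext (LinearMap.congr_fun h1 x) (LinearMap.congr_fun h2 x)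
  have hle : lp (ModuleCat.of A (N × Y)) ≤ lp N := by
    intro X hX
    refine ⟨hX.1, ?_⟩
    rintro _ rfl f
    have h1 := hX.2 _ rfl (LinearMap.inl A _ Y ∘ₗ f)
    ext x
    exact congrArg Prod.fst (LinearMap.congr_fun h1 x)
  have heq : lp (ModuleCat.of A (N × Y)) = lp N := by
    by_contra hne
    exact hmin _ hprod (lt_of_le_of_ne hle hne)
  have htf := torfClosure_isTorsionFree (A := A) (fun X => X = N) (by rintro _ rfl; exact hfN)
  refine htf.perp_perp Y ⟨hfY, fun M hM f => ?_⟩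
  have h1 : (lp N).1 M := ⟨hM.1, by
    rintro _ rfl g
    exact hM.2 _ (fun F _ h => h _ rfl) g⟩
  rw [← heq] at h1
  have h2 := h1.2 _ rfl (LinearMap.inr A N Y ∘ₗ f)
  ext x
  exact congrArg Prod.snd (LinearMap.congr_fun h2 x)

theorem isFac_wide {T : ModuleCat.{0} A → Prop} (hT : IsTorsionClass A T) (h : IsFac T) :
    ∃ S : Set (ModuleCat.{0} A), IsSemibrick A S ∧ T = torsClosure A (fun X => X ∈ S) := by
  choose lab hlab using fun U : {U | IsMaxBelow T U} => IsMaxBelow.exists_label hT U.2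
  refine ⟨Set.range lab, ⟨?_, ?_⟩, ?_⟩
  · rintro _ ⟨U, rfl⟩
    exact (hlab U).brick hT
  · rintro _ ⟨U, rfl⟩ _ ⟨V, rfl⟩ hne f
    refine IsLabel.orth hT U.2 V.2 (fun h => hne ?_) (hlab U) (hlab V) f
    rw [Subtype.ext h]
  · by_contra hne
    have hS := torsClosure_isTorsion (A := A) (fun X => X ∈ Set.range lab) (by
      rintro _ ⟨U, rfl⟩; exact hT.fin _ (hlab U).mem)
    obtain ⟨U, hU, hle⟩ := exists_max hT h hS (fun X hX => hX T hT (by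
      rintro _ ⟨U, rfl⟩; exact (hlab U).mem)) (fun h => hne h.symm)
    have h1 := hlab ⟨U, hU⟩
    exact nonzero_absurd (hle _ (fun T' _ h => h _ ⟨⟨U, hU⟩, rfl⟩)) h1.perp h1.nz

theorem wf_transfer {α β : Type*} [PartialOrder α] [PartialOrder β] (e : α ≃o βᵒᵈ)
    (h : WellFoundedGT α) : WellFoundedLT β := by
  refine ⟨Subrelation.wf (r := InvImage (· > ·) (fun b : β => e.symm (OrderDual.toDual b))) ?_
    (InvImage.wf _ h.wf)⟩
  intro a b hab
  exact e.symm.strictMono (a := OrderDual.toDual b) (b := OrderDual.toDual a) hab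

theorem wf_transfer' {α β : Type*} [PartialOrder α] [PartialOrder β] (e : α ≃o βᵒᵈ)
    (h : WellFoundedGT β) : WellFoundedLT α := by
  refine ⟨Subrelation.wf (r := InvImage (· > ·) (fun a : α => OrderDual.ofDual (e a))) ?_
    (InvImage.wf _ h.wf)⟩
  intro a b hab
  exact e.strictMono hab

theorem imp_e_b (K : Type) [Field K] [Algebra K A] [FiniteDimensional K A]
    [IsArtinianRing Aᵐᵒᵖ] (h : ∀ T : ModuleCat.{0} A → Prop, IsTorsionClass A T →
      IsCompactTors A T) : Finite (Tors A) := by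
  have h1 : WellFoundedGT (Tors A) := by
    apply acc_of_compact
    intro T
    obtain ⟨M, hM, hT⟩ := h T.1 T.2
    have hT' : T = gen M hM := Subtype.ext hT
    rw [hT']
    exact ⟨M, mem_gen M hM, gen_le M hM⟩
  obtain ⟨e⟩ := exists_iso K A
  have h2 : Finite (Tors Aᵐᵒᵖ) := finite_of_dcc K (wf_transfer e h1)
  have h3 : Finite (Tors Aᵐᵒᵖ)ᵒᵈ := h2
  exact Finite.of_equiv _ e.symm.toEquiv

theorem imp_f_b (K : Type) [Field K] [Algebra K A] [FiniteDimensional K A]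
    [IsArtinianRing Aᵐᵒᵖ] (h : ∀ T : ModuleCat.{0} A → Prop, IsTorsionClass A T →
      ∃ S : Set (ModuleCat.{0} A), IsSemibrick A S ∧ T = torsClosure A (fun X => X ∈ S)) :
    Finite (Tors A) := by
  obtain ⟨e⟩ := exists_iso K A
  suffices hall : ∀ S : Tors Aᵐᵒᵖ, IsFac S.1 from
    finite_of_dcc K (wf_transfer' e (acc_of_isFac hall))
  by_contra hno
  push Not at hno
  obtain ⟨S0, hS0⟩ := hno
  obtain ⟨S, _, hS⟩ := zorn_le_nonempty₀ {S : Tors Aᵐᵒᵖ | ¬ IsFac S.1} (by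
    intro c hcS hc y hy
    have hc' : IsChain (· ≤ ·) (Subtype.val '' c) := by
      rintro _ ⟨a, ha, rfl⟩ _ ⟨b, hb, rfl⟩ _
      exact hc.total ha hb
    let W : Tors Aᵐᵒᵖ := ⟨_, isTorsion_sUnion hc' ⟨_, y, hy, rfl⟩ (by rintro _ ⟨a, _, rfl⟩; exact a.2)⟩
    have hle : ∀ z ∈ c, z ≤ W := fun z hz X hX => ⟨z.1, ⟨z, hz, rfl⟩, hX⟩
    refine ⟨W, fun hW => ?_, hle⟩
    obtain ⟨M, ⟨_, ⟨z, hz, rfl⟩, hM⟩, hgen⟩ := hW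
    have hWz : W ≤ z := IsFac.le_of_mem (T := W.1) hgen z.2 hM
    have : W = z := le_antisymm hWz (hle z hz)
    apply hcS hz
    rw [← this]
    exact ⟨M, ⟨_, ⟨z, hz, rfl⟩, hM⟩, hgen⟩) S0 hS0
  have hmax : ∀ S' : Tors Aᵐᵒᵖ, S < S' → IsFac S'.1 := by
    intro S' hlt
    by_contra hn
    exact absurd (hS.le_of_ge hn hlt.le) (not_le_of_gt hlt)
  let T : Tors A := e.symm (OrderDual.toDual S)
  have hTe : e T = OrderDual.toDual S := e.apply_symm_apply _
  obtain ⟨Q, hQ, hTQ⟩ := h T.1 T.2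
  have hQT : ∀ X ∈ Q, T.1 X := by
    intro X hX
    rw [hTQ]
    exact fun T' _ h => h X hX
  have hTmin : ∀ T' : Tors A, (∀ X ∈ Q, T'.1 X) → T ≤ T' := by
    intro T' h' X hX
    rw [hTQ] at hX
    exact hX T'.1 T'.2 h'
  have hne : Q.Nonempty := by
    rw [Set.nonempty_iff_ne_empty]
    rintro rfl
    have h1 := hTmin (e.symm (OrderDual.toDual topTors)) (by simp)
    have h2 : OrderDual.toDual S ≤ OrderDual.toDual topTors := e.symm.le_iff_le.1 h1
    have h3 : topTors ≤ S := h2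
    have h4 : S = topTors := le_antisymm (le_topTors S) h3
    apply hS.prop
    rw [h4]; exact isFac_top
  obtain ⟨B, hBQ⟩ := hne
  have hBb := hQ.1 B hBQ
  let T' : Tors A := ⟨_, T.2.perp B⟩
  have hT'T : T' < T := by
    refine lt_of_le_of_ne (fun X hX => hX.1) (fun heq => ?_)
    have h1 : T'.1 B := by rw [heq]; exact hQT B hBQ
    obtain ⟨b, hb⟩ := hBb.2.1
    exact hb (LinearMap.congr_fun (h1.2 LinearMap.id) b)
  let S1 : Tors Aᵐᵒᵖ := OrderDual.ofDual (e T')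
  have hSS1 : S < S1 := by
    have h1 : e T' < e T := e.strictMono hT'T
    rw [hTe] at h1
    exact h1
  have hS1 := hmax S1 hSS1
  obtain ⟨U, hU, hSU⟩ := exists_max S1.2 hS1 S.2 hSS1.le (fun h => hSS1.ne (Subtype.ext h))
  have hUf := isFac_max K S1.2 hS1 hU
  let U' : Tors Aᵐᵒᵖ := ⟨U, hU.tors⟩
  have hSU' : S < U' := lt_of_le_of_ne hSU (fun h => hS.prop (by rw [h]; exact hUf))
  have hUS1 : U' < S1 := lt_of_le_of_ne hU.le (fun h => hU.ne (congrArg Subtype.val h))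
  let T'' : Tors A := e.symm (OrderDual.toDual U')
  have hlt1 : T' < T'' := by
    have h1 : OrderDual.toDual S1 < OrderDual.toDual U' := hUS1
    have h2 := e.symm.strictMono h1
    have h3 : e.symm (OrderDual.toDual S1) = T' := e.symm_apply_apply T'
    rwa [h3] at h2
  have hlt2 : T'' < T := by
    have h1 : OrderDual.toDual U' < OrderDual.toDual S := hSU'
    exact e.symm.strictMono h1
  have hex : ∃ X, T''.1 X ∧ ¬ T'.1 X :=
    exists_of_lt hlt1.le (fun h => hlt1.ne (Subtype.ext h))
  obtain ⟨X, hX, hX'⟩ := hex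
  have hTX := hlt2.le X hX
  have hf : ∃ f : X →ₗ[A] B, f ≠ 0 := by
    by_contra hno
    push Not at hno
    exact hX' ⟨hTX, hno⟩
  obtain ⟨f, hf⟩ := hf
  have hzs := hTmin ⟨_, T.2.zeroOrSurj B⟩ (by
    intro Y hY
    refine ⟨hQT Y hY, fun g => ?_⟩
    by_cases hYB : Y = B
    · subst hYB
      by_cases hg : g = 0
      · left; exact hg
      · right; exact (hBb.2.2 g hg).2
    · left; exact hQ.2 Y hY B hBQ hYB g)
  have hfs := ((hzs X hTX).2 f).resolve_left hf
  have hB'' : T''.1 B := T''.2.surj hX f hfs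
  refine absurd (hTmin T'' fun Y hY => ?_) (not_le_of_gt hlt2)
  by_cases hYB : Y = B
  · rw [hYB]; exact hB''
  · exact hlt1.le Y ⟨hQT Y hY, fun g => hQ.2 Y hY B hBQ hYB g⟩

end Implications

/-- The following are equivalent: (a) `A` is brick finite;
(b) there are only finitely many torsion classes; (c) every torsion class is functorially
finite; (d) every torsion class is bicompact; (e) every torsion class is compact;
(f) every torsion class is widely generated. -/
theorem stmt14 (K : Type) [Field K] [Algebra K A] [FiniteDimensional K A] :
    List.TFAE [
      ∃ (m : ℕ) (f : Fin m → ModuleCat.{0} A),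
        ∀ M : ModuleCat.{0} A, IsBrick A M → ∃ i, Nonempty (M ≃ₗ[A] f i),
      {T : ModuleCat.{0} A → Prop | IsTorsionClass A T}.Finite,
      ∀ T : ModuleCat.{0} A → Prop, IsTorsionClass A T → FunctoriallyFinite A T,
      ∀ T : ModuleCat.{0} A → Prop, IsTorsionClass A T → IsBicompactTors A T,
      ∀ T : ModuleCat.{0} A → Prop, IsTorsionClass A T → IsCompactTors A T,
      ∀ T : ModuleCat.{0} A → Prop, IsTorsionClass A T →
        ∃ S : Set (ModuleCat.{0} A), IsSemibrick A S ∧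
          T = torsClosure A (fun X => X ∈ S)] := by
  have hA : IsArtinianRing A := IsArtinianRing.of_finite K A
  have hA' : IsArtinianRing Aᵐᵒᵖ := IsArtinianRing.of_finite K Aᵐᵒᵖ
  have hb : {T : ModuleCat.{0} A → Prop | IsTorsionClass A T}.Finite ↔ Finite (Tors A) :=
    Set.finite_coe_iff.symm
  rw [hb]
  tfae_have 1 → 2 := imp_a_b
  tfae_have 2 → 1 := imp_b_a
  tfae_have 2 → 3 := fun h T hT => isFac_functFinite K hT (all_isFac_of_finite K h ⟨T, hT⟩)
  tfae_have 3 → 5 := fun h T hT => imp_c_e hT (h T hT)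
  tfae_have 2 → 4 := fun h T hT =>
    ⟨isFac_compact hT (all_isFac_of_finite K h ⟨T, hT⟩), imp_b_cocompact h⟩
  tfae_have 4 → 5 := fun h T hT => (h T hT).1
  tfae_have 5 → 2 := imp_e_b K
  tfae_have 2 → 6 := fun h T hT => isFac_wide hT (all_isFac_of_finite K h ⟨T, hT⟩)
  tfae_have 6 → 2 := imp_f_b K
  tfae_finish
end TorsPaper
end

section
/- Let K be an algebraically closed field and A a finite dimensional hereditary K-algebra. Then every bicompact torsion class 𝒯 in mod A is numerically disjoint: there exist no nonzero X ∈ 𝒯 and Y ∈ 𝒯^⊥ having the same class in K0(mod A) (the same multiset of composition factors). -/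
namespace TorsPaper

section pencil
variable {K V W : Type*} [Field K] [AddCommGroup V] [Module K V] [FiniteDimensional K V]
  [AddCommGroup W] [Module K W]

/-- Upper semicontinuity of the kernel dimension along a pencil. -/
theorem pencil_ker (L D : V →ₗ[K] W) :
    {t : K | Module.finrank K (LinearMap.ker L) <
      Module.finrank K (LinearMap.ker (L + t • D))}.Finite := by
  obtain ⟨C, hC⟩ := Submodule.exists_isCompl (LinearMap.ker L)
  have hinj : LinearMap.ker (L.comp C.subtype) = ⊥ := by
    rw [LinearMap.ker_eq_bot']
    intro x hx
    have : (x : V) ∈ LinearMap.ker L ⊓ C := ⟨hx, x.2⟩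
    rw [hC.inf_eq_bot] at this
    exact Subtype.ext this
  obtain ⟨p, hp⟩ := (L.comp C.subtype).exists_leftInverse_of_injective hinj
  let E : Module.End K C := p.comp (D.comp C.subtype)
  have hfin := Module.End.finite_hasEigenvalue E
  have : {t : K | ∃ v : C, v ≠ 0 ∧ v + t • E v = 0}.Finite := by
    refine (hfin.preimage (f := fun t : K => -t⁻¹) ?_).subset ?_
    · intro a _ b _ h
      simpa using h
    · rintro t ⟨v, hv, h⟩
      have ht : t ≠ 0 := by
        rintro rfl
        simp at h; exact hv h
      refine Module.End.hasEigenvalue_of_hasEigenvector (x := v)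
        (Module.End.hasEigenvector_iff.2 ⟨Module.End.mem_eigenspace_iff.2 ?_, hv⟩)
      have h2 : t • E v = -v := by
        rw [eq_neg_iff_add_eq_zero, add_comm]; exact h
      calc E v = t⁻¹ • (t • E v) := by rw [smul_smul, inv_mul_cancel₀ ht, one_smul]
        _ = _ := by rw [h2]; simp
  refine this.subset ?_
  intro t ht
  by_contra hcon
  simp only [Set.mem_ofPred_eq, not_exists, not_and] at hcon ht
  refine absurd ht (not_lt.2 ?_)
  have hd : Disjoint (LinearMap.ker (L + t • D)) C := by
    rw [Submodule.disjoint_def]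
    intro x hx hxC
    by_contra hx0
    refine hcon ⟨x, hxC⟩ (fun h => hx0 (congrArg Subtype.val h)) ?_
    have h1 : p (L x) = ⟨x, hxC⟩ := LinearMap.congr_fun hp ⟨x, hxC⟩
    have h2 : p ((L + t • D) x) = 0 := by
      rw [LinearMap.mem_ker.1 hx, map_zero]
    rw [LinearMap.add_apply, map_add, h1, LinearMap.smul_apply, map_smul] at h2
    exact h2
  have h1 := Submodule.finrank_add_finrank_le_of_disjoint hd
  have h2 := Submodule.finrank_add_eq_of_isCompl hC
  omega

theorem pencil_ker_one (L L' : V →ₗ[K] W) :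
    {t : K | Module.finrank K (LinearMap.ker L') <
      Module.finrank K (LinearMap.ker (L + t • (L' - L)))}.Finite := by
  refine ((pencil_ker L' (L' - L)).preimage (f := fun t : K => t - 1) ?_).subset ?_
  · intro a _ b _ h
    simpa using h
  · intro t ht
    have : L + t • (L' - L) = L' + (t - 1) • (L' - L) := by
      rw [sub_smul, one_smul]; abel
    show Module.finrank K (LinearMap.ker L') <
      Module.finrank K (LinearMap.ker (L' + (t - 1) • (L' - L)))
    rw [← this]
    exact ht
end pencil
section homs
variable {K A : Type} [Field K] [Ring A] [Algebra K A]
variable {P P' N : Type} [AddCommGroup P] [Module A P] [AddCommGroup P'] [Module A P']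
  [AddCommGroup N] [Module A N] [Module K N] [IsScalarTower K A N]

theorem finHom (K : Type) [Field K] [Algebra K A] [Module K N] [IsScalarTower K A N]
    [Module.Finite A P] [FiniteDimensional K N] :
    FiniteDimensional K (P →ₗ[A] N) := by
  obtain ⟨n, π, hπ⟩ := Module.Finite.exists_fin' A P
  let Φ : (P →ₗ[A] N) →ₗ[K] (Fin n → N) :=
    { toFun := fun f i => f (π (Pi.single i 1))
      map_add' := fun _ _ => rfl
      map_smul' := fun _ _ => rfl }
  refine FiniteDimensional.of_injective Φ ?_
  intro f g h
  have : f.comp π = g.comp π := by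
    refine LinearMap.pi_ext' fun i => LinearMap.ext_ring ?_
    exact congrFun h i
  exact LinearMap.cancel_right hπ |>.1 this

/-- precomposition as a `K`-linear map -/
def precomp (K : Type) [Field K] [Algebra K A] (N : Type) [AddCommGroup N] [Module A N]
    [Module K N] [IsScalarTower K A N] (f : P →ₗ[A] P') : (P' →ₗ[A] N) →ₗ[K] (P →ₗ[A] N) where
  toFun g := g.comp f
  map_add' _ _ := rfl
  map_smul' _ _ := rfl

theorem hom_congr (e : P ≃ₗ[A] P') :
    Module.finrank K (P →ₗ[A] N) = Module.finrank K (P' →ₗ[A] N) :=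
  LinearEquiv.finrank_eq
    (LinearEquiv.ofLinearMap (precomp K N e.symm.toLinearMap) (precomp K N e.toLinearMap)
      (by ext f x; simp [precomp]) (by ext f x; simp [precomp]))

theorem hom_prod [Module.Finite A P] [Module.Finite A P'] [FiniteDimensional K N] :
    Module.finrank K (P × P' →ₗ[A] N) =
      Module.finrank K (P →ₗ[A] N) + Module.finrank K (P' →ₗ[A] N) := by
  have := finHom (A := A) (P := P) (N := N) K
  have := finHom (A := A) (P := P') (N := N) K
  rw [← Module.finrank_prod]
  exact (LinearEquiv.finrank_eq (LinearMap.coprodEquiv (R := A) K)).symm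

/-- A surjection onto a projective splits. -/
theorem split_proj [Module.Projective A P'] (f : P →ₗ[A] P') (hf : Function.Surjective f) :
    Nonempty (P ≃ₗ[A] (P' × LinearMap.ker f)) := by
  obtain ⟨s, hs⟩ := Module.projective_lifting_property f LinearMap.id hf
  have hs' : ∀ x, f (s x) = x := fun x => LinearMap.congr_fun hs x
  refine ⟨LinearEquiv.ofLinearMap
    (f.prod (LinearMap.codRestrict (LinearMap.ker f) (LinearMap.id - s.comp f)
      (fun x => by simp [hs'])))
    (s.coprod (LinearMap.ker f).subtype) ?_ ?_⟩
  · apply LinearMap.ext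
    rintro ⟨x, y, hy⟩
    have hy' : f y = 0 := hy
    refine Prod.ext ?_ (Subtype.ext ?_)
    · simp [hs', hy']
    · simp [hs', hy']
  · ext x; simp

/-- Schanuel, numerically. -/
theorem schanuel_num {X P Q : Type} [AddCommGroup P] [Module A P] [AddCommGroup Q] [Module A Q]
    [AddCommGroup X] [Module A X] [IsNoetherianRing A]
    [Module.Finite A P] [Module.Finite A Q] [Module.Projective A P] [Module.Projective A Q]
    [FiniteDimensional K N]
    (p : P →ₗ[A] X) (q : Q →ₗ[A] X) (hp : Function.Surjective p) (hq : Function.Surjective q) :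
    (Module.finrank K (P →ₗ[A] N) : ℤ) - Module.finrank K (LinearMap.ker p →ₗ[A] N) =
    (Module.finrank K (Q →ₗ[A] N) : ℤ) - Module.finrank K (LinearMap.ker q →ₗ[A] N) := by
  let E : Submodule A (P × Q) := LinearMap.ker (p.comp (LinearMap.fst A P Q) - q.comp (LinearMap.snd A P Q))
  have hE : ∀ z : E, p z.1.1 = q z.1.2 := fun z => by
    have h := LinearMap.mem_ker.1 z.2
    rwa [LinearMap.sub_apply, sub_eq_zero] at h
  have memE : ∀ x y, p x = q y → (x, y) ∈ E := fun x y h => by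
    simp [E, h]
  let a : E →ₗ[A] P := (LinearMap.fst A P Q).comp E.subtype
  let b : E →ₗ[A] Q := (LinearMap.snd A P Q).comp E.subtype
  have ha : Function.Surjective a := fun x => by
    obtain ⟨y, hy⟩ := hq (p x)
    exact ⟨⟨(x, y), memE _ _ hy.symm⟩, rfl⟩
  have hb : Function.Surjective b := fun y => by
    obtain ⟨x, hx⟩ := hp (q y)
    exact ⟨⟨(x, y), memE _ _ hx⟩, rfl⟩
  have ka : Nonempty (LinearMap.ker a ≃ₗ[A] LinearMap.ker q) := by
    refine ⟨LinearEquiv.ofBijective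
      (LinearMap.codRestrict (LinearMap.ker q) (b.comp (LinearMap.ker a).subtype) ?_) ⟨?_, ?_⟩⟩
    · rintro ⟨z, hz⟩
      have hz' : z.1.1 = 0 := hz
      have := hE z
      rw [hz', map_zero] at this
      exact this.symm
    · rintro ⟨z, hz⟩ ⟨w, hw⟩ h
      have hz' : z.1.1 = 0 := hz
      have hw' : w.1.1 = 0 := hw
      have h' : z.1.2 = w.1.2 := congrArg Subtype.val h
      exact Subtype.ext (Subtype.ext (Prod.ext (hz'.trans hw'.symm) h'))
    · rintro ⟨y, hy⟩
      have hy' : q y = 0 := hy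
      exact ⟨⟨⟨(0, y), memE _ _ (by rw [map_zero, hy'])⟩, rfl⟩, rfl⟩
  have kb : Nonempty (LinearMap.ker b ≃ₗ[A] LinearMap.ker p) := by
    refine ⟨LinearEquiv.ofBijective
      (LinearMap.codRestrict (LinearMap.ker p) (a.comp (LinearMap.ker b).subtype) ?_) ⟨?_, ?_⟩⟩
    · rintro ⟨z, hz⟩
      have hz' : z.1.2 = 0 := hz
      have := hE z
      rw [hz', map_zero] at this
      exact this
    · rintro ⟨z, hz⟩ ⟨w, hw⟩ h
      have hz' : z.1.2 = 0 := hz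
      have hw' : w.1.2 = 0 := hw
      have h' : z.1.1 = w.1.1 := congrArg Subtype.val h
      exact Subtype.ext (Subtype.ext (Prod.ext h' (hz'.trans hw'.symm)))
    · rintro ⟨y, hy⟩
      have hy' : p y = 0 := hy
      exact ⟨⟨⟨(y, 0), memE _ _ (by rw [map_zero, hy'])⟩, rfl⟩, rfl⟩
  obtain ⟨ka⟩ := ka
  obtain ⟨kb⟩ := kb
  obtain ⟨sa⟩ := split_proj a ha
  obtain ⟨sb⟩ := split_proj b hb
  have e1 := hom_congr (K := K) (A := A) (P := E) (P' := P × LinearMap.ker a) (N := N) sa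
  have e2 := hom_congr (K := K) (A := A) (P := E) (P' := Q × LinearMap.ker b) (N := N) sb
  have e3 := hom_congr (K := K) (A := A) (P := LinearMap.ker a) (P' := LinearMap.ker q) (N := N) ka
  have e4 := hom_congr (K := K) (A := A) (P := LinearMap.ker b) (P' := LinearMap.ker p) (N := N) kb
  rw [hom_prod] at e1 e2
  omega
end homs

section semis
variable {K A : Type} [Field K] [Ring A] [Algebra K A]

theorem fdSub {U : Type} [AddCommGroup U] [Module A U] [Module K U] [IsScalarTower K A U]
    [FiniteDimensional K U] (S : Submodule A U) : FiniteDimensional K S :=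
  FiniteDimensional.of_injective (S.subtype.restrictScalars K) S.subtype_injective

/-- Semisimple modules are determined by Hom dimensions. -/
theorem semis_iso (n : ℕ) : ∀ (U V : Type) [AddCommGroup U] [Module A U] [Module K U]
    [IsScalarTower K A U] [AddCommGroup V] [Module A V] [Module K V] [IsScalarTower K A V]
    [FiniteDimensional K U] [FiniteDimensional K V] [IsSemisimpleModule A U]
    [IsSemisimpleModule A V], Module.finrank K U = n →
    (∀ (S : Type) [AddCommGroup S] [Module A S] [Module K S] [IsScalarTower K A S]
      [FiniteDimensional K S] [IsSemisimpleModule A S],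
      Module.finrank K (U →ₗ[A] S) = Module.finrank K (V →ₗ[A] S)) →
    Nonempty (U ≃ₗ[A] V) := by
  induction n using Nat.strong_induction_on with
  | _ n ih =>
  intro U V _ _ _ _ _ _ _ _ _ _ _ _ hn h
  have : Module.Finite A U := Module.Finite.of_restrictScalars_finite K A U
  have : Module.Finite A V := Module.Finite.of_restrictScalars_finite K A V
  rcases subsingleton_or_nontrivial U with hU | hU
  · have h1 := h V
    have := finHom (A := A) (P := V) (N := V) K
    rw [Module.finrank_zero_of_subsingleton] at h1
    have h2 : (LinearMap.id : V →ₗ[A] V) = 0 := by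
      have := Module.finrank_zero_iff.1 h1.symm
      exact Subsingleton.elim _ _
    have : Subsingleton V := ⟨fun x y => by
      rw [← LinearMap.id_apply (R := A) x, ← LinearMap.id_apply (R := A) y, h2]; rfl⟩
    exact ⟨LinearEquiv.ofSubsingleton U V⟩
  · obtain ⟨S, hS⟩ := IsSemisimpleModule.exists_simple_submodule A U
    obtain ⟨C, hC⟩ := exists_isCompl S
    have := fdSub (K := K) S
    have := fdSub (K := K) C
    have : Nontrivial S := IsSimpleModule.nontrivial A S
    have hne : ∃ g : V →ₗ[A] S, g ≠ 0 := by
      by_contra hcon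
      push Not at hcon
      have h1 := h S
      have : Subsingleton (V →ₗ[A] S) := ⟨fun a b => by rw [hcon a, hcon b]⟩
      rw [Module.finrank_zero_of_subsingleton (M := V →ₗ[A] S)] at h1
      have := finHom (A := A) (P := U) (N := S) K
      have := Module.finrank_zero_iff.1 h1
      have h3 : S.projectionOnto C hC = 0 := Subsingleton.elim _ _
      obtain ⟨x, hx⟩ := exists_ne (0 : S)
      apply hx
      rw [← Submodule.projectionOnto_apply_left hC x, h3]; rfl
    obtain ⟨g, hg⟩ := hne
    have hgs : Function.Surjective g := LinearMap.surjective_of_ne_zero hg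
    obtain ⟨D, hD⟩ := exists_isCompl (LinearMap.ker g)
    let eD : D ≃ₗ[A] S := ((Submodule.quotientEquivOfIsCompl _ D hD).symm.trans
      (g.quotKerEquivOfSurjective hgs))
    let eU : (S × C) ≃ₗ[A] U := Submodule.prodEquivOfIsCompl S C hC
    let eV : (D × LinearMap.ker g) ≃ₗ[A] V := Submodule.prodEquivOfIsCompl D _ hD.symm
    have := fdSub (K := K) (LinearMap.ker g)
    have hlt : Module.finrank K C < n := by
      have h1 := (eU.restrictScalars K).finrank_eq
      rw [Module.finrank_prod] at h1
      have h2 : 0 < Module.finrank K S := Module.finrank_pos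
      omega
    obtain ⟨e⟩ := ih _ hlt C (LinearMap.ker g) rfl (by
      intro W _ _ _ _ _ _
      have e1 := h W
      rw [← hom_congr eU, ← hom_congr eV, hom_prod, hom_prod, hom_congr eD] at e1
      omega)
    exact ⟨eU.symm.trans ((LinearEquiv.prodCongr eD.symm e).trans eV)⟩

end semis
section proj
variable {K A : Type} [Field K] [Ring A] [Algebra K A]

theorem top_hom {P S : Type} [AddCommGroup P] [Module A P] [AddCommGroup S] [Module A S]
    [Module K S] [IsScalarTower K A S] [IsSemisimpleModule A S] :
    Module.finrank K ((P ⧸ Module.jacobson A P) →ₗ[A] S) = Module.finrank K (P →ₗ[A] S) := by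
  refine (LinearEquiv.ofBijective (precomp K S (Module.jacobson A P).mkQ) ⟨?_, ?_⟩).finrank_eq
  · intro f g h
    exact (LinearMap.cancel_right (Submodule.mkQ_surjective _)).1 h
  · intro g
    refine ⟨(Module.jacobson A P).liftQ g ?_, ?_⟩
    · refine (Module.le_comap_jacobson g).trans ?_
      rw [IsSemisimpleModule.jacobson_eq_bot A S]
      exact le_rfl
    · exact Submodule.liftQ_mkQ _ _ _

theorem lift_top {P P' : Type} [AddCommGroup P] [Module A P] [AddCommGroup P'] [Module A P']
    [Module.Projective A P] [Module.Finite A P']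
    (e : (P ⧸ Module.jacobson A P) →ₗ[A] (P' ⧸ Module.jacobson A P'))
    (he : Function.Surjective e) :
    ∃ f : P →ₗ[A] P', Function.Surjective f := by
  obtain ⟨f, hf⟩ := Module.projective_lifting_property (Module.jacobson A P').mkQ
    (e.comp (Module.jacobson A P).mkQ) (Submodule.mkQ_surjective _)
  refine ⟨f, ?_⟩
  rw [← LinearMap.range_eq_top]
  rcases eq_top_or_exists_le_coatom (LinearMap.range f) with h | ⟨m, hm, hle⟩
  · exact h
  · exfalso
    apply hm.1
    rw [eq_top_iff]
    intro y _
    obtain ⟨u, hu⟩ := he ((Module.jacobson A P').mkQ y)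
    obtain ⟨x, rfl⟩ := Submodule.mkQ_surjective _ u
    have h1 : (Module.jacobson A P').mkQ (f x) = (Module.jacobson A P').mkQ y := by
      rw [← hu]; exact LinearMap.congr_fun hf x
    have h2 : y - f x ∈ Module.jacobson A P' := by
      rw [← (Module.jacobson A P').ker_mkQ, LinearMap.mem_ker, map_sub, h1, sub_self]
    have h3 : y - f x ∈ m := (sInf_le (a := m) hm : Module.jacobson A P' ≤ m) h2
    have h4 : f x ∈ m := hle ⟨x, rfl⟩
    simpa using m.add_mem h3 h4

theorem fdQuot {U : Type} [AddCommGroup U] [Module A U] [Module K U] [IsScalarTower K A U]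
    [FiniteDimensional K U] (S : Submodule A U) : FiniteDimensional K (U ⧸ S) :=
  Module.Finite.of_surjective (S.mkQ.restrictScalars K) S.mkQ_surjective

theorem proj_iso {P P' : Type} [AddCommGroup P] [Module A P] [Module K P] [IsScalarTower K A P]
    [AddCommGroup P'] [Module A P'] [Module K P'] [IsScalarTower K A P']
    [FiniteDimensional K P] [FiniteDimensional K P']
    [Module.Projective A P] [Module.Projective A P']
    (h : ∀ (S : Type) [AddCommGroup S] [Module A S] [Module K S] [IsScalarTower K A S]
      [FiniteDimensional K S] ,
      Module.finrank K (P →ₗ[A] S) = Module.finrank K (P' →ₗ[A] S)) :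
    Nonempty (P ≃ₗ[A] P') := by
  have : Module.Finite A P := Module.Finite.of_restrictScalars_finite K A P
  have : Module.Finite A P' := Module.Finite.of_restrictScalars_finite K A P'
  have : FiniteDimensional K (P ⧸ Module.jacobson A P) :=
    fdQuot (Module.jacobson A P)
  have : FiniteDimensional K (P' ⧸ Module.jacobson A P') :=
    fdQuot (Module.jacobson A P')
  have : IsArtinian A (P ⧸ Module.jacobson A P) := isArtinian_of_tower K inferInstance
  have : IsArtinian A (P' ⧸ Module.jacobson A P') := isArtinian_of_tower K inferInstance
  have : IsSemisimpleModule A (P ⧸ Module.jacobson A P) :=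
    (IsArtinian.isSemisimpleModule_iff_jacobson A _).2 (Module.jacobson_quotient_jacobson A P)
  have : IsSemisimpleModule A (P' ⧸ Module.jacobson A P') :=
    (IsArtinian.isSemisimpleModule_iff_jacobson A _).2 (Module.jacobson_quotient_jacobson A P')
  have hS : ∀ (S : Type) [AddCommGroup S] [Module A S] [Module K S] [IsScalarTower K A S]
      [FiniteDimensional K S] [IsSemisimpleModule A S],
      Module.finrank K ((P ⧸ Module.jacobson A P) →ₗ[A] S) =
        Module.finrank K ((P' ⧸ Module.jacobson A P') →ₗ[A] S) := by
    intro S _ _ _ _ _ _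
    have e1 := top_hom (K := K) (A := A) (P := P) (S := S)
    have e2 := top_hom (K := K) (A := A) (P := P') (S := S)
    have e3 := h S
    exact e1.trans (e3.trans e2.symm)
  obtain ⟨e⟩ := semis_iso (K := K) (A := A) _ (P ⧸ Module.jacobson A P)
    (P' ⧸ Module.jacobson A P') rfl hS
  obtain ⟨f, hf⟩ := lift_top e.toLinearMap e.surjective
  obtain ⟨g, hg⟩ := lift_top e.symm.toLinearMap e.symm.surjective
  have h1 := LinearMap.finrank_le_finrank_of_surjective (f := f.restrictScalars K) hf
  have h2 := LinearMap.finrank_le_finrank_of_surjective (f := g.restrictScalars K) hg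
  have hi : Function.Injective (f.restrictScalars K) :=
    (LinearMap.injective_iff_surjective_of_finrank_eq_finrank (le_antisymm h2 h1)).2 hf
  exact ⟨LinearEquiv.ofBijective f ⟨hi, hf⟩⟩
end proj

section euler
variable {K A : Type} [Field K] [Ring A] [Algebra K A]

open Classical in
/-- The Euler form `⟨X, N⟩` over a hereditary algebra. -/
noncomputable def eulerF (K A : Type) [Field K] [Ring A] [Algebra K A]
    (N : Type) [AddCommGroup N] [Module A N] [Module K N] [IsScalarTower K A N]
    (X : ModuleCat.{0} A) : ℤ :=
  if h : Module.Finite A X then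
    (Module.finrank K ((Fin (Module.Finite.exists_fin' A X).choose → A) →ₗ[A] N) : ℤ) -
      Module.finrank K (LinearMap.ker (Module.Finite.exists_fin' A X).choose_spec.choose →ₗ[A] N)
  else 0

theorem eulerF_eq [IsNoetherianRing A] {N : Type} [AddCommGroup N] [Module A N] [Module K N]
    [IsScalarTower K A N] [FiniteDimensional K N] (X : ModuleCat.{0} A) [h : Module.Finite A X]
    {P : Type} [AddCommGroup P] [Module A P] [Module.Finite A P] [Module.Projective A P]
    (p : P →ₗ[A] X) (hp : Function.Surjective p) :
    eulerF K A N X =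
      (Module.finrank K (P →ₗ[A] N) : ℤ) - Module.finrank K (LinearMap.ker p →ₗ[A] N) := by
  rw [eulerF, dif_pos h]
  exact schanuel_num _ _ (Module.Finite.exists_fin' A X).choose_spec.choose_spec hp

theorem eulerF_additive [IsNoetherianRing A]
    (H : ∀ (P : Type) [AddCommGroup P] [Module A P] [Module.Finite A P] [Module.Projective A P]
      (N : Submodule A P), Module.Projective A N)
    {N : Type} [AddCommGroup N] [Module A N] [Module K N]
    [IsScalarTower K A N] [FiniteDimensional K N] : IsAdditiveZ A (eulerF K A N) := by
  intro L M R hL hM hR f g hf hg hfg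
  obtain ⟨n, p, hp⟩ := Module.Finite.exists_fin' A M
  have := H _ (LinearMap.ker (g.comp p))
  -- the map from the kernel to L
  let q0 : LinearMap.ker (g.comp p) →ₗ[A] LinearMap.range f :=
    LinearMap.codRestrict _ (p.comp (Submodule.subtype _)) (fun x => by
      rw [hfg]; exact x.2)
  let eL := LinearEquiv.ofInjective f hf
  let q : LinearMap.ker (g.comp p) →ₗ[A] L := eL.symm.toLinearMap.comp q0
  have hq0 : Function.Surjective q0 := by
    rintro ⟨y, hy⟩
    obtain ⟨x, rfl⟩ := hp y
    refine ⟨⟨x, ?_⟩, rfl⟩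
    rw [hfg] at hy
    exact hy
  have hq : Function.Surjective q := eL.symm.surjective.comp hq0
  have ek : Nonempty (LinearMap.ker q ≃ₗ[A] LinearMap.ker p) := by
    have key : ∀ x, q x = 0 ↔ p x.1 = 0 := fun x => by
      constructor
      · intro h
        have h0 : q0 x = 0 := eL.symm.map_eq_zero_iff.1 h
        exact congrArg Subtype.val h0
      · intro h
        have h0 : q0 x = 0 := Subtype.ext h
        exact eL.symm.map_eq_zero_iff.2 h0
    refine ⟨LinearEquiv.ofBijective (LinearMap.codRestrict _
      ((Submodule.subtype _).comp (Submodule.subtype _)) (fun x => (key x.1).1 x.2)) ⟨?_, ?_⟩⟩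
    · intro x y h
      have h' : x.1.1 = y.1.1 := congrArg (fun z : LinearMap.ker p => (z : Fin n → A)) h
      exact Subtype.ext (Subtype.ext h')
    · rintro ⟨x, hx⟩
      have hx' : p x = 0 := hx
      refine ⟨⟨⟨x, ?_⟩, ?_⟩, rfl⟩
      · simp [hx']
      · exact (key _).2 hx'
  obtain ⟨ek⟩ := ek
  have e1 := hom_congr (K := K) (A := A) (P := LinearMap.ker q) (P' := LinearMap.ker p) (N := N) ek
  rw [eulerF_eq L q hq, eulerF_eq M p hp, eulerF_eq R (g.comp p) (hg.comp hp), e1]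
  ring
end euler

section pairs
variable {K A : Type} [Field K] [Ring A] [Algebra K A]
variable {R Q1 Q0 Z : Type} [AddCommGroup R] [Module A R] [AddCommGroup Q1] [Module A Q1]
  [AddCommGroup Q0] [Module A Q0] [AddCommGroup Z] [Module A Z]
  [Module K Q1] [IsScalarTower K A Q1] [Module K Q0] [IsScalarTower K A Q0]

/-- The map whose kernel is the space of maps of presentations. -/
def pairMap (K : Type) [Field K] [Algebra K A] [Module K Q1] [IsScalarTower K A Q1] [Module K Q0]
    [IsScalarTower K A Q0] (R1 : Submodule A R) (f : Q1 →ₗ[A] Q0) :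
    ((R →ₗ[A] Q0) × (R1 →ₗ[A] Q1)) →ₗ[K] (R1 →ₗ[A] Q0) where
  toFun ab := ab.1.comp R1.subtype - f.comp ab.2
  map_add' x y := by
    ext z; simp; abel
  map_smul' c x := by
    ext z
    have : f (c • x.2 z) = c • f (x.2 z) := (f.restrictScalars K).map_smul c _
    simp [this, smul_sub]

theorem pairMap_pencil (R1 : Submodule A R) (f g : Q1 →ₗ[A] Q0) (t : K) :
    pairMap K R1 (f + t • (g - f)) = pairMap K R1 f + t • (pairMap K R1 g - pairMap K R1 f) := by
  apply LinearMap.ext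
  intro ab
  ext z
  simp [pairMap]
  simp only [smul_sub]
  abel

/-- homotopies -/
def homotopyMap (R1 : Submodule A R) (f : Q1 →ₗ[A] Q0) :
    (R →ₗ[A] Q1) →ₗ[K] ((R →ₗ[A] Q0) × (R1 →ₗ[A] Q1)) where
  toFun c := (f.comp c, c.comp R1.subtype)
  map_add' x y := by
    refine Prod.ext ?_ ?_ <;> ext z <;> simp
  map_smul' k x := by
    refine Prod.ext ?_ ?_ 
    · ext z
      exact (f.restrictScalars K).map_smul k _
    · ext z; simp

variable [IsNoetherianRing A] [Module.Finite A R] [FiniteDimensional K Q1] [FiniteDimensional K Q0]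

theorem pair_dim_le (R1 : Submodule A R) (f : Q1 →ₗ[A] Q0) (hf : Function.Injective f)
    (p : Q0 →ₗ[A] Z) (hfp : LinearMap.range f = LinearMap.ker p)
    (h0 : ∀ u : (R ⧸ R1) →ₗ[A] Z, u = 0) :
    Module.finrank K (LinearMap.ker (pairMap K R1 f)) ≤ Module.finrank K (R →ₗ[A] Q1) := by
  have := finHom (A := A) (P := R) (N := Q1) K
  have := finHom (A := A) (P := R) (N := Q0) K
  have := finHom (A := A) (P := R1) (N := Q1) K
  have hle : LinearMap.ker (pairMap K R1 f) ≤ LinearMap.range (homotopyMap (K := K) R1 f) := by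
    rintro ⟨a, b⟩ hab
    have hab' : ∀ x : R1, a x.1 = f (b x) := fun x => by
      have := LinearMap.congr_fun (LinearMap.mem_ker.1 hab) x
      exact sub_eq_zero.1 this
    have hpf : ∀ x, p (f x) = 0 := fun x => by
      have : f x ∈ LinearMap.ker p := hfp ▸ ⟨x, rfl⟩
      exact this
    have hu := h0 (R1.liftQ (p.comp a) (by
      intro x hx
      have := hab' ⟨x, hx⟩
      simp only at this
      simp [this, hpf]))
    have hz : ∀ x, a x ∈ LinearMap.range f := fun x => by
      rw [hfp]
      have := LinearMap.congr_fun hu (R1.mkQ x)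
      simpa using this
    let c : R →ₗ[A] Q1 := (LinearEquiv.ofInjective f hf).symm.toLinearMap.comp
      (LinearMap.codRestrict _ a hz)
    have hc : ∀ x, f (c x) = a x := fun x => by
      have := (LinearEquiv.ofInjective f hf).apply_symm_apply (⟨a x, hz x⟩)
      exact congrArg Subtype.val this
    refine ⟨c, Prod.ext (LinearMap.ext hc) (LinearMap.ext fun x => hf ?_)⟩
    exact (hc x.1).trans (hab' x)
  exact (Submodule.finrank_mono hle).trans (LinearMap.finrank_range_le _)

theorem pair_zero [Module.Projective A R] (R1 : Submodule A R) (f : Q1 →ₗ[A] Q0)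
    (hf : Function.Injective f)
    (hd : Module.finrank K (LinearMap.ker (pairMap K R1 f)) ≤ Module.finrank K (R →ₗ[A] Q1))
    (u : (R ⧸ R1) →ₗ[A] (Q0 ⧸ LinearMap.range f)) : u = 0 := by
  have := finHom (A := A) (P := R) (N := Q1) K
  have := finHom (A := A) (P := R) (N := Q0) K
  have := finHom (A := A) (P := R1) (N := Q1) K
  have hinj : Function.Injective (homotopyMap (K := K) R1 f) := by
    intro c d h
    ext x
    exact hf (LinearMap.congr_fun (congrArg Prod.fst h) x)
  have hle : LinearMap.range (homotopyMap (K := K) R1 f) ≤ LinearMap.ker (pairMap K R1 f) := by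
    rintro _ ⟨c, rfl⟩
    rw [LinearMap.mem_ker]
    ext x
    simp [pairMap, homotopyMap]
  have heq := Submodule.eq_of_le_of_finrank_le hle (by
    rw [LinearMap.finrank_range_of_inj hinj]; exact hd)
  obtain ⟨a, ha⟩ := Module.projective_lifting_property (LinearMap.range f).mkQ (u.comp R1.mkQ)
    (Submodule.mkQ_surjective _)
  have ha' : ∀ x, (LinearMap.range f).mkQ (a x) = u (R1.mkQ x) := fun x => LinearMap.congr_fun ha x
  have hz : ∀ x : R1, a x.1 ∈ LinearMap.range f := fun x => by
    rw [← (LinearMap.range f).ker_mkQ, LinearMap.mem_ker, ha']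
    have : R1.mkQ x.1 = 0 := by simp
    rw [this, map_zero]
  let b : R1 →ₗ[A] Q1 := (LinearEquiv.ofInjective f hf).symm.toLinearMap.comp
      (LinearMap.codRestrict _ (a.comp R1.subtype) hz)
  have hb : ∀ x, f (b x) = a x.1 := fun x => by
    have := (LinearEquiv.ofInjective f hf).apply_symm_apply (⟨a x.1, hz x⟩)
    exact congrArg Subtype.val this
  have hab : (a, b) ∈ LinearMap.ker (pairMap K R1 f) := by
    rw [LinearMap.mem_ker]
    ext x
    simp [pairMap, hb]
  rw [← heq] at hab
  obtain ⟨c, hc⟩ := hab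
  have hc' : ∀ x, f (c x) = a x := fun x => LinearMap.congr_fun (congrArg Prod.fst hc) x
  refine (LinearMap.cancel_right (Submodule.mkQ_surjective R1)).1 ?_
  ext x
  have := ha' x
  rw [← hc' x] at this
  simp only [LinearMap.comp_apply, LinearMap.zero_apply]
  rw [← this]
  simp
end pairs
section core
variable {A : Type} [Ring A]
variable {R Q1 Q0 X Y N : Type} [AddCommGroup R] [Module A R] [AddCommGroup Q1] [Module A Q1]
  [AddCommGroup Q0] [Module A Q0] [AddCommGroup X] [Module A X] [AddCommGroup Y] [Module A Y]
  [AddCommGroup N] [Module A N]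

theorem precomp_pencil {K : Type} [Field K] [Algebra K A] [Module K Q0] [IsScalarTower K A Q0]
    [Module K N] [IsScalarTower K A N] (f g : Q1 →ₗ[A] Q0) (t : K) :
    precomp K N (f + t • (g - f)) = precomp K N f + t • (precomp K N g - precomp K N f) := by
  apply LinearMap.ext
  intro a
  ext z
  have : ∀ y, a (t • y) = t • a y := fun y => (a.restrictScalars K).map_smul t y
  simp [precomp, this]

/-- Openness of both vanishing conditions along the pencil spanned by two presentations. -/
theorem core (K : Type) [Field K] [Infinite K] [Algebra K A]
    [Module K Q1] [IsScalarTower K A Q1] [Module K Q0] [IsScalarTower K A Q0]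
    [Module K N] [IsScalarTower K A N] [IsNoetherianRing A] [Module.Finite A R]
    [Module.Projective A R]
    [FiniteDimensional K Q1] [FiniteDimensional K Q0] [FiniteDimensional K N]
    (R1 : Submodule A R) (f g : Q1 →ₗ[A] Q0)
    (hf : Function.Injective f) (hg : Function.Injective g)
    (p : Q0 →ₗ[A] X) (hp : Function.Surjective p) (hfp : LinearMap.range f = LinearMap.ker p)
    (q : Q0 →ₗ[A] Y) (hgq : LinearMap.range g = LinearMap.ker q)
    (hX : ∀ u : X →ₗ[A] N, u = 0) (hY : ∀ u : (R ⧸ R1) →ₗ[A] Y, u = 0)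
    (hX0 : ∃ x : X, x ≠ 0) :
    ∃ h : Q1 →ₗ[A] Q0, ¬ Function.Surjective h ∧
      (∀ u : (Q0 ⧸ LinearMap.range h) →ₗ[A] N, u = 0) ∧
      (∀ u : (R ⧸ R1) →ₗ[A] (Q0 ⧸ LinearMap.range h), u = 0) := by
  have : Module.Finite A Q0 := Module.Finite.of_restrictScalars_finite K A Q0
  have : Module.Finite A Q1 := Module.Finite.of_restrictScalars_finite K A Q1
  have := finHom (A := A) (P := Q0) (N := N) K
  have := finHom (A := A) (P := R) (N := Q0) K
  have := finHom (A := A) (P := R1) (N := Q1) K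
  have F1 := pencil_ker (K := K) (f.restrictScalars K) ((g - f).restrictScalars K)
  have F2 := pencil_ker (K := K) (precomp K N f) (precomp K N g - precomp K N f)
  have F3 := pencil_ker_one (K := K) (pairMap K R1 f) (pairMap K R1 g)
  obtain ⟨t, ht⟩ := ((F1.union F2).union F3).infinite_compl.nonempty
  have ht1 : Module.finrank K (LinearMap.ker (f.restrictScalars K + t • (g - f).restrictScalars K))
      ≤ Module.finrank K (LinearMap.ker (f.restrictScalars K)) :=
    not_lt.1 fun h => ht (Or.inl (Or.inl h))
  have ht2 : Module.finrank K (LinearMap.ker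
      (precomp K N f + t • (precomp K N g - precomp K N f)))
      ≤ Module.finrank K (LinearMap.ker (precomp K N f)) :=
    not_lt.1 fun h => ht (Or.inl (Or.inr h))
  have ht3 : Module.finrank K (LinearMap.ker
      (pairMap K R1 f + t • (pairMap K R1 g - pairMap K R1 f)))
      ≤ Module.finrank K (LinearMap.ker (pairMap K R1 g)) :=
    not_lt.1 fun h => ht (Or.inr h)
  rw [← precomp_pencil] at ht2
  rw [← pairMap_pencil] at ht3
  let h : Q1 →ₗ[A] Q0 := f + t • (g - f)
  change Module.finrank K (LinearMap.ker (h.restrictScalars K)) ≤ _ at ht1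
  change Module.finrank K (LinearMap.ker (precomp K N h)) ≤ _ at ht2
  change Module.finrank K (LinearMap.ker (pairMap K R1 h)) ≤ _ at ht3
  have hh : Function.Injective h := by
    have h0 : LinearMap.ker (f.restrictScalars K) = ⊥ := LinearMap.ker_eq_bot.2 hf
    rw [h0, finrank_bot, Nat.le_zero, Submodule.finrank_eq_zero] at ht1
    have h1 : Function.Injective (h.restrictScalars K) := LinearMap.ker_eq_bot.1 ht1
    exact h1
  refine ⟨h, ?_, ?_, ?_⟩
  · intro hs
    have hfin : Module.finrank K Q1 = Module.finrank K Q0 :=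
      (LinearEquiv.ofBijective (h.restrictScalars K) ⟨hh, hs⟩).finrank_eq
    have hfs : Function.Surjective (f.restrictScalars K) :=
      (LinearMap.injective_iff_surjective_of_finrank_eq_finrank hfin).1 hf
    obtain ⟨x, hx⟩ := hX0
    obtain ⟨y, rfl⟩ := hp x
    obtain ⟨z, rfl⟩ := hfs y
    apply hx
    have : f z ∈ LinearMap.ker p := hfp ▸ ⟨z, rfl⟩
    exact this
  · have h0 : LinearMap.ker (precomp K N f) = ⊥ := by
      rw [LinearMap.ker_eq_bot']
      intro a ha
      have hle : LinearMap.ker p ≤ LinearMap.ker a := by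
        rw [← hfp]
        rintro _ ⟨z, rfl⟩
        exact LinearMap.congr_fun ha z
      have hu := hX (((LinearMap.ker p).liftQ a hle).comp
        (p.quotKerEquivOfSurjective hp).symm.toLinearMap)
      ext x
      have := LinearMap.congr_fun hu (p x)
      have e : (p.quotKerEquivOfSurjective hp).symm (p x) = (LinearMap.ker p).mkQ x := by
        rw [LinearEquiv.symm_apply_eq]; rfl
      rw [LinearMap.comp_apply, LinearEquiv.coe_coe, e] at this
      simpa using this
    rw [h0, finrank_bot, Nat.le_zero, Submodule.finrank_eq_zero] at ht2
    intro u
    have hz : u.comp (LinearMap.range h).mkQ = 0 := by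
      have : u.comp (LinearMap.range h).mkQ ∈ LinearMap.ker (precomp K N h) := by
        rw [LinearMap.mem_ker]
        ext x
        have : (LinearMap.range h).mkQ (h x) = 0 := by simp
        change u ((LinearMap.range h).mkQ (h x)) = 0
        rw [this, map_zero]
      rw [ht2] at this
      exact this
    exact (LinearMap.cancel_right (LinearMap.range h).mkQ_surjective).1
      (hz.trans (LinearMap.zero_comp _).symm)
  · exact pair_zero R1 h hh (ht3.trans (pair_dim_le R1 g hg q hgq hY))
end core

section classes
variable {A : Type} [Ring A]

theorem leftPerp_tors (Y : ModuleCat.{0} A) : IsTorsionClass A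
    (fun X => Module.Finite A X ∧ ∀ f : X →ₗ[A] Y, f = 0) where
  fin _ h := h.1
  zero M h := by
    have : Subsingleton M := ⟨fun x y => by rw [h x, h y]⟩
    refine ⟨inferInstance, fun f => LinearMap.ext fun x => ?_⟩
    rw [h x, map_zero, map_zero]
  quot M N hM hN := by
    rintro ⟨g, hg⟩
    exact ⟨hN, fun f => (LinearMap.cancel_right hg).1 ((hM.2 _).trans (LinearMap.zero_comp _).symm)⟩
  ext M hM N h1 h2 := by
    refine ⟨hM, fun f => ?_⟩
    have e1 : ∀ x : N, f x.1 = 0 := fun x => LinearMap.congr_fun (h1.2 (f.comp N.subtype)) x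
    have e2 := h2.2 (N.liftQ f (fun x hx => e1 ⟨x, hx⟩))
    ext x
    exact LinearMap.congr_fun e2 (N.mkQ x)

theorem rightPerp_torf (Z : ModuleCat.{0} A) : IsTorsionFreeClass A
    (fun W => Module.Finite A W ∧ ∀ f : Z →ₗ[A] W, f = 0) where
  fin _ h := h.1
  zero M h := by
    have : Subsingleton M := ⟨fun x y => by rw [h x, h y]⟩
    exact ⟨inferInstance, fun f => LinearMap.ext fun x => h _⟩
  sub M N hM hN := by
    rintro ⟨g, hg⟩
    refine ⟨hN, fun f => LinearMap.ext fun x => hg ?_⟩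
    have := LinearMap.congr_fun (hM.2 (g.comp f)) x
    simpa using this
  ext M hM N h1 h2 := by
    refine ⟨hM, fun f => ?_⟩
    have e2 : ∀ x, f x ∈ N := fun x => by
      have := LinearMap.congr_fun (h2.2 (N.mkQ.comp f)) x
      rw [← N.ker_mkQ]
      exact this
    have e1 := h1.2 (f.codRestrict N e2)
    ext x
    exact congrArg Subtype.val (LinearMap.congr_fun e1 x)
end classes

theorem main_aux (A : Type) [Ring A] (K : Type) [Field K] [Infinite K]
    [Algebra K A] [FiniteDimensional K A]
    (hered : ∀ M : ModuleCat.{0} A, Module.Finite A M → Module.Projective A M →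
      ∀ N : Submodule A M, Module.Projective A N)
    (T : ModuleCat.{0} A → Prop)
    (hbc : IsBicompactTors A T) :
    NumericallyDisjoint A T (rightPerp A T) := by
  rintro ⟨X, Y, hX, hY, hX0, -, hXY⟩
  obtain ⟨⟨M, hM, hTM⟩, N, hN, hFN⟩ := hbc
  have H : ∀ (P : Type) [AddCommGroup P] [Module A P] [Module.Finite A P] [Module.Projective A P]
      (N : Submodule A P), Module.Projective A N := fun P _ _ h1 h2 N =>
    hered (ModuleCat.of A P) h1 h2 N
  have hnoeth : IsNoetherianRing A := IsNoetherianRing.of_finite K A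
  have hMT : T M := by
    rw [hTM]; intro T' _ h; exact h M rfl
  have hNF : rightPerp A T N := by
    rw [hFN]; intro T' _ h; exact h N rfl
  have hXN : ∀ u : X →ₗ[A] N, u = 0 := hNF.2 X hX
  have hMY : ∀ u : M →ₗ[A] Y, u = 0 := hY.2 M hMT
  have hXf : Module.Finite A X := by
    rw [hTM] at hX
    exact (hX _ (leftPerp_tors N) (by rintro _ rfl; exact ⟨hM, hNF.2 _ hMT⟩)).1
  have hYf : Module.Finite A Y := hY.1
  let : Module K N := Module.compHom N (algebraMap K A)
  have : IsScalarTower K A N := ⟨fun k a n => by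
    rw [Algebra.smul_def, mul_smul]; rfl⟩
  have : FiniteDimensional K N := Module.Finite.trans A N
  obtain ⟨n, p, hp⟩ := Module.Finite.exists_fin' A X
  obtain ⟨m, q, hq⟩ := Module.Finite.exists_fin' A Y
  obtain ⟨r, s, hs⟩ := Module.Finite.exists_fin' A M
  have := H _ (LinearMap.ker p)
  have := H _ (LinearMap.ker q)
  have := fdSub (K := K) (LinearMap.ker p)
  have := fdSub (K := K) (LinearMap.ker q)
  have hiso : Nonempty ((LinearMap.ker p × (Fin m → A)) ≃ₗ[A] ((Fin n → A) × LinearMap.ker q)) := by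
    refine proj_iso (K := K) ?_
    intro S _ _ _ _ _
    have h1 := hXY _ (eulerF_additive (K := K) (A := A) H (N := S))
    rw [eulerF_eq X p hp, eulerF_eq Y q hq] at h1
    rw [hom_prod, hom_prod]
    omega
  obtain ⟨e⟩ := hiso
  let f : (LinearMap.ker p × LinearMap.ker q) →ₗ[A] ((Fin n → A) × LinearMap.ker q) :=
    LinearMap.prodMap (LinearMap.ker p).subtype LinearMap.id
  let g0 : (LinearMap.ker p × LinearMap.ker q) →ₗ[A] (LinearMap.ker p × (Fin m → A)) :=
    LinearMap.prodMap LinearMap.id (LinearMap.ker q).subtype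
  obtain ⟨h, hns, hZN, hMZ⟩ := core (A := A) (N := N) K (LinearMap.ker s) f
    (e.toLinearMap.comp g0)
    (by
      rintro ⟨a, b⟩ ⟨c, d⟩ hh
      have h1 : a.1 = c.1 := congrArg Prod.fst hh
      have h2 : b = d := congrArg Prod.snd hh
      exact Prod.ext (Subtype.ext h1) h2)
    (by
      refine e.injective.comp ?_
      rintro ⟨a, b⟩ ⟨c, d⟩ hh
      have h1 : a = c := congrArg Prod.fst hh
      have h2 : b.1 = d.1 := congrArg Prod.snd hh
      exact Prod.ext h1 (Subtype.ext h2))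
    (p.comp (LinearMap.fst A _ _)) (hp.comp Prod.fst_surjective)
    (by
      ext ⟨a, b⟩
      constructor
      · rintro ⟨⟨c, d⟩, hcd⟩
        have h1 : c.1 = a := congrArg Prod.fst hcd
        have h2 : p c.1 = 0 := c.2
        rw [h1] at h2
        exact h2
      · intro ha
        exact ⟨(⟨a, ha⟩, b), rfl⟩)
    ((q.comp (LinearMap.snd A _ _)).comp e.symm.toLinearMap)
    (by
      ext z
      constructor
      · rintro ⟨⟨c, d⟩, rfl⟩
        have h2 : q d.1 = 0 := d.2
        rw [LinearMap.mem_ker]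
        simp [g0]
      · intro ha
        obtain ⟨⟨a, b⟩, rfl⟩ := e.surjective z
        rw [LinearMap.mem_ker] at ha
        have hb : q b = 0 := by simpa using ha
        exact ⟨(a, ⟨b, hb⟩), rfl⟩)
    hXN
    (by
      intro u
      have h1 := hMY (u.comp (s.quotKerEquivOfSurjective hs).symm.toLinearMap)
      refine LinearMap.ext fun z => ?_
      have h2 := LinearMap.congr_fun h1 ((s.quotKerEquivOfSurjective hs) z)
      simpa using h2)
    hX0
  let Z : ModuleCat.{0} A := ModuleCat.of A (((Fin n → A) × LinearMap.ker q) ⧸ LinearMap.range h)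
  have hZf : Module.Finite A Z :=
    inferInstanceAs (Module.Finite A (((Fin n → A) × LinearMap.ker q) ⧸ LinearMap.range h))
  have hMZ' : ∀ u : M →ₗ[A] Z, u = 0 := by
    intro u
    have h1 := hMZ (u.comp (s.quotKerEquivOfSurjective hs).toLinearMap)
    ext x
    have h2 := LinearMap.congr_fun h1 ((s.quotKerEquivOfSurjective hs).symm x)
    rw [LinearMap.comp_apply, LinearEquiv.coe_coe, LinearEquiv.apply_symm_apply] at h2
    exact h2
  have hZF : rightPerp A T Z := by
    refine ⟨hZf, fun W hW => ?_⟩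
    rw [hTM] at hW
    exact (hW _ (leftPerp_tors Z) (by rintro _ rfl; exact ⟨hM, hMZ'⟩)).2
  rw [hFN] at hZF
  have hid := (hZF _ (rightPerp_torf Z) (by rintro _ rfl; exact ⟨hN, hZN⟩)).2 LinearMap.id
  apply hns
  rw [← LinearMap.range_eq_top, eq_top_iff]
  intro y _
  rw [← (LinearMap.range h).ker_mkQ, LinearMap.mem_ker]
  exact LinearMap.congr_fun hid ((LinearMap.range h).mkQ y)

end TorsPaper

namespace TorsPaper

variable (A : Type) [Ring A]

/-- Over an algebraically closed field, every bicompact torsion class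
over a finite dimensional hereditary algebra is numerically disjoint. -/
theorem stmt15 (K : Type) [Field K] [IsAlgClosed K]
    [Algebra K A] [FiniteDimensional K A]
    (hered : ∀ M : ModuleCat.{0} A, Module.Finite A M → Module.Projective A M →
      ∀ N : Submodule A M, Module.Projective A N)
    (T : ModuleCat.{0} A → Prop) (hT : IsTorsionClass A T)
    (hbc : IsBicompactTors A T) :
    NumericallyDisjoint A T (rightPerp A T) := by
  exact main_aux A K hered T hbc
end TorsPaper
end
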